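/- arXiv:2502.09737 — 9 statements merged into one kernel-verified Lean document; each statement's English description precedes it below -/
import Mathlib

section
/- Let f : ℝ^n → ℝ^n and J : ℝ^n → ℝ be continuously differentiable, let u : [0,∞) → ℝ^n be differentiable with u'(t) = f(u(t)) for all t ≥ 0, and let J̄ ∈ ℝ. Suppose ψ : [0,∞) → ℝ^n is differentiable and satisfies ψ'(t) + Df(u(t))ᵀψ(t) + ∇J(u(t)) = 0 for all t ≥ 0, and that (1/T)∫₀ᵀ ψ(t)·f(u(t)) dt → 0 and (1/T)∫₀ᵀ J(u(t)) dt → J̄ as T → ∞. Then ψ(t)·f(u(t)) = J̄ − J(u(t)) for every t ≥ 0. -/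
open scoped RealInnerProductSpace
open Filter

/-- A real function with zero derivative on `[0,∞)` is constant there. -/
theorem eq_apply_zero_of_hasDerivAt_zero {g : ℝ → ℝ}
    (hg : ∀ t : ℝ, 0 ≤ t → HasDerivAt g 0 t) {t : ℝ} (ht : 0 ≤ t) : g t = g 0 :=
  constant_of_has_deriv_right_zero
    (fun x hx => (hg x hx.1).continuousAt.continuousWithinAt)
    (fun x hx => (hg x hx.1).hasDerivWithinAt) t ⟨ht, le_rfl⟩

/-- If `g + h` equals `c` on `[0,∞)`, then the time averages of `g` and `h` add up to `c`. -/
theorem add_eq_of_tendsto_average {g h : ℝ → ℝ} {a b c : ℝ}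
    (hg : ∀ t : ℝ, 0 ≤ t → ContinuousAt g t) (hh : ∀ t : ℝ, 0 ≤ t → ContinuousAt h t)
    (hc : ∀ t : ℝ, 0 ≤ t → g t + h t = c)
    (ha : Tendsto (fun T : ℝ => (1 / T) * ∫ t in (0:ℝ)..T, g t) atTop (nhds a))
    (hb : Tendsto (fun T : ℝ => (1 / T) * ∫ t in (0:ℝ)..T, h t) atTop (nhds b)) :
    a + b = c := by
  refine tendsto_nhds_unique (ha.add hb) (tendsto_const_nhds.congr' ?_)
  filter_upwards [eventually_gt_atTop 0] with T hT
  have integrable {k : ℝ → ℝ} (hk : ∀ t : ℝ, 0 ≤ t → ContinuousAt k t) :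
      IntervalIntegrable k MeasureTheory.volume 0 T := by
    refine ContinuousOn.intervalIntegrable fun t ht => (hk t ?_).continuousWithinAt
    rw [Set.uIcc_of_le hT.le] at ht
    exact ht.1
  have hsum : ∫ t in (0:ℝ)..T, (g t + h t) = ∫ _ in (0:ℝ)..T, c := by
    refine intervalIntegral.integral_congr fun t ht => hc t ?_
    rw [Set.uIcc_of_le hT.le] at ht
    exact ht.1
  rw [← mul_add, ← intervalIntegral.integral_add (integrable hg) (integrable hh), hsum,
    intervalIntegral.integral_const, smul_eq_mul, sub_zero]
  field_simp

/-- **Adjoint shadowing direction identity.**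
If `u' = f(u)` on `[0,∞)`, `ψ` solves the adjoint equation
`ψ' + Df(u)ᵀ ψ + ∇J(u) = 0` on `[0,∞)`, the time average of `⟪ψ, f(u)⟫` tends to `0`
and the time average of `J(u)` tends to `J̄`, then `⟪ψ(t), f(u(t))⟫ = J̄ − J(u(t))`
for every `t ≥ 0`. -/
theorem adjoint_shadowing_inner_f
    (n : ℕ)
    (f : EuclideanSpace ℝ (Fin n) → EuclideanSpace ℝ (Fin n))
    (J : EuclideanSpace ℝ (Fin n) → ℝ)
    (hf : ContDiff ℝ 1 f) (hJ : ContDiff ℝ 1 J)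
    (u ψ : ℝ → EuclideanSpace ℝ (Fin n))
    (Jbar : ℝ)
    (hu : ∀ t : ℝ, 0 ≤ t → HasDerivAt u (f (u t)) t)
    (hψ : ∀ t : ℝ, 0 ≤ t →
      HasDerivAt ψ
        (-(ContinuousLinearMap.adjoint (fderiv ℝ f (u t))) (ψ t) - gradient J (u t)) t)
    (havg_psi_f :
      Tendsto (fun T : ℝ => (1 / T) * ∫ t in (0:ℝ)..T, ⟪ψ t, f (u t)⟫) atTop (nhds 0))
    (havg_J :
      Tendsto (fun T : ℝ => (1 / T) * ∫ t in (0:ℝ)..T, J (u t)) atTop (nhds Jbar)) :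
    ∀ t : ℝ, 0 ≤ t → ⟪ψ t, f (u t)⟫ = Jbar - J (u t) := by
  intro t ht
  have hfu (s : ℝ) (hs : 0 ≤ s) :
      HasDerivAt (fun r => f (u r)) (fderiv ℝ f (u s) (f (u s))) s :=
    ((hf.differentiable one_ne_zero).differentiableAt.hasFDerivAt).comp_hasDerivAt s (hu s hs)
  have hJu (s : ℝ) (hs : 0 ≤ s) : HasDerivAt (fun r => J (u r)) ⟪gradient J (u s), f (u s)⟫ s :=
    ((hJ.differentiable one_ne_zero).differentiableAt.hasGradientAt.hasFDerivAt).comp_hasDerivAt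
      s (hu s hs)
  have hinner (s : ℝ) (hs : 0 ≤ s) := (hψ s hs).inner ℝ (hfu s hs)
  have hconst (s : ℝ) (hs : 0 ≤ s) :
      ⟪ψ s, f (u s)⟫ + J (u s) = ⟪ψ 0, f (u 0)⟫ + J (u 0) := by
    refine eq_apply_zero_of_hasDerivAt_zero (g := fun r => ⟪ψ r, f (u r)⟫ + J (u r))
      (fun r hr => ((hinner r hr).add (hJu r hr)).congr_deriv ?_) hs
    rw [inner_sub_left, inner_neg_left, ContinuousLinearMap.adjoint_inner_left]
    ring
  have hlim := add_eq_of_tendsto_average (fun s hs => (hinner s hs).continuousAt)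
    (fun s hs => (hJu s hs).continuousAt) hconst havg_psi_f havg_J
  linarith [hconst t ht]
end

section
/- Let T > 0, let A : [0,T] → ℝ^{n×n} be continuous, let λ₁,…,λ_n ∈ ℝ, and let φ̂₁,…,φ̂_n : [0,T] → ℝ^n be differentiable with −φ̂_i'(t) = A(t)ᵀφ̂_i(t) − λ_iφ̂_i(t) for all i and all t ∈ [0,T]. Suppose there is c_min > 0 such that the matrix Φ(t) with columns φ̂₁(t),…,φ̂_n(t) satisfies c_min‖c‖² ≤ ‖Φ(t)c‖² for all c ∈ ℝ^n and t ∈ [0,T]. Let ê₁,…,ê_n : [0,T] → ℝ be continuously differentiable with ê_i(0) = ê_i(T) = 0 for all i, and set e(t) = Σ_{i=1}^n ê_i(t)φ̂_i(t). Then Σ_{i=1}^n c_min(1/T² + λ_i²) ∫₀ᵀ ê_i(t)² dt ≤ ∫₀ᵀ ‖e'(t) + A(t)ᵀe(t)‖² dt. -/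
open scoped RealInnerProductSpace
open Set

/-- A pointwise inequality whose last two terms form the derivative of
`s ↦ (l - (2 * s - T) / T ^ 2) * x s ^ 2`. -/
theorem weighted_sq_add_deriv_le {T t : ℝ} (ht : t ∈ Icc 0 T) (l x y : ℝ) :
    (1 / T ^ 2 + l ^ 2) * x ^ 2
      + (-(2 / T ^ 2) * x ^ 2 + (l - (2 * t - T) / T ^ 2) * (2 * x * y)) ≤ (y + l * x) ^ 2 := by
  have hg : ((2 * t - T) / T ^ 2) ^ 2 ≤ 1 / T ^ 2 := by
    rcases eq_or_ne T 0 with rfl | h0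
    · simp
    · rw [div_pow, div_le_div_iff₀ (by positivity) (by positivity)]
      have : (2 * t - T) ^ 2 ≤ T ^ 2 := by nlinarith [ht.1, ht.2]
      nlinarith [mul_le_mul_of_nonneg_right this (sq_nonneg T)]
  have h2 : 2 / T ^ 2 = 2 * (1 / T ^ 2) := by ring
  rw [h2]
  nlinarith [sq_nonneg (y + (2 * t - T) / T ^ 2 * x),
    mul_le_mul_of_nonneg_right hg (sq_nonneg x)]

/-- The one-dimensional Poincaré-type inequality for `f' + l f` on `[0, T]` with Dirichlet
boundary conditions. -/
theorem integral_sq_le_integral_deriv_add_mul_sq {T : ℝ} (hT : 0 ≤ T) (l : ℝ) {f : ℝ → ℝ}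
    (hf : ContDiff ℝ 1 f) (hf0 : f 0 = 0) (hfT : f T = 0) :
    (1 / T ^ 2 + l ^ 2) * ∫ t in (0:ℝ)..T, f t ^ 2
      ≤ ∫ t in (0:ℝ)..T, (deriv f t + l * f t) ^ 2 := by
  have hc : Continuous f := hf.continuous
  have hc' : Continuous (deriv f) := hf.continuous_deriv le_rfl
  have hd : ∀ t, HasDerivAt f (deriv f t) t :=
    fun t => (hf.differentiable one_ne_zero t).hasDerivAt
  have hF : ∀ t, HasDerivAt (fun s => (l - (2 * s - T) / T ^ 2) * f s ^ 2)
      (-(2 / T ^ 2) * f t ^ 2 + (l - (2 * t - T) / T ^ 2) * (2 * f t * deriv f t)) t := by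
    intro t
    have h1 : HasDerivAt (fun s : ℝ => l - (2 * s - T) / T ^ 2) (-(2 / T ^ 2)) t := by
      simpa using ((((hasDerivAt_id t).const_mul 2).sub_const T).div_const (T ^ 2)).const_sub l
    simpa using h1.fun_mul ((hd t).fun_pow 2)
  have hFc : Continuous fun t => -(2 / T ^ 2) * f t ^ 2
      + (l - (2 * t - T) / T ^ 2) * (2 * f t * deriv f t) := by fun_prop
  have hFTC := intervalIntegral.integral_eq_sub_of_hasDerivAt (fun t _ => hF t)
    (hFc.intervalIntegrable 0 T)
  have hfc : Continuous fun t => (1 / T ^ 2 + l ^ 2) * f t ^ 2 := by fun_prop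
  have hadd := intervalIntegral.integral_add (hfc.intervalIntegrable 0 T)
    (hFc.intervalIntegrable 0 T) (μ := MeasureTheory.volume)
  have hle := intervalIntegral.integral_mono_on (μ := MeasureTheory.volume) hT
    ((hfc.add hFc).intervalIntegrable 0 T)
    ((show Continuous fun t => (deriv f t + l * f t) ^ 2 by fun_prop).intervalIntegrable 0 T)
    (fun t ht => weighted_sq_add_deriv_le ht l (f t) (deriv f t))
  rw [hFTC, hf0, hfT, intervalIntegral.integral_const_mul] at hadd
  simp only [Pi.add_apply] at hle
  linarith

/-- **Lower bound on `‖e' + Aᵀe‖₂²` in the adjoint Lyapunov basis.**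
If the `φ̂ᵢ` are adjoint covariant Lyapunov vectors (`−φ̂ᵢ' = Aᵀφ̂ᵢ − λᵢφ̂ᵢ`), the matrix with
columns `φ̂ᵢ(t)` is bounded below (`c_min‖c‖² ≤ ‖Φ(t)c‖²`), and
`e(t) = Σᵢ êᵢ(t)φ̂ᵢ(t)` with `êᵢ(0) = êᵢ(T) = 0`, then
`Σᵢ c_min(1/T² + λᵢ²)∫₀ᵀ êᵢ² ≤ ∫₀ᵀ ‖e' + Aᵀe‖²`. -/
theorem lyapunov_coordinate_lower_bound
    (n : ℕ) (T : ℝ) (hT : 0 < T)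
    (A : ℝ → EuclideanSpace ℝ (Fin n) →L[ℝ] EuclideanSpace ℝ (Fin n))
    (hA : ContinuousOn A (Icc 0 T))
    (lam : Fin n → ℝ)
    (phihat : Fin n → ℝ → EuclideanSpace ℝ (Fin n))
    (hphi : ∀ i, ∀ t ∈ Icc (0:ℝ) T,
      HasDerivAt (phihat i)
        (-(ContinuousLinearMap.adjoint (A t)) (phihat i t) + lam i • phihat i t) t)
    (cmin : ℝ) (hcmin : 0 < cmin)
    (hlow : ∀ (c : Fin n → ℝ), ∀ t ∈ Icc (0:ℝ) T,
      cmin * ∑ i, (c i) ^ 2 ≤ ‖∑ i, c i • phihat i t‖ ^ 2)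
    (ehat : Fin n → ℝ → ℝ)
    (hehat : ∀ i, ContDiff ℝ 1 (ehat i))
    (hehat0 : ∀ i, ehat i 0 = 0) (hehatT : ∀ i, ehat i T = 0) :
    ∑ i, cmin * (1 / T ^ 2 + (lam i) ^ 2) * ∫ t in (0:ℝ)..T, (ehat i t) ^ 2
      ≤ ∫ t in (0:ℝ)..T,
          ‖deriv (fun s => ∑ i, ehat i s • phihat i s) t
            + (ContinuousLinearMap.adjoint (A t)) (∑ i, ehat i t • phihat i t)‖ ^ 2 := by
  have hc : ∀ i, Continuous (ehat i) := fun i => (hehat i).continuous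
  have hc' : ∀ i, Continuous (deriv (ehat i)) := fun i => (hehat i).continuous_deriv le_rfl
  have hphic : ∀ i, ContinuousOn (phihat i) (Icc 0 T) :=
    fun i t ht => (hphi i t ht).continuousAt.continuousWithinAt
  have hexpand : ∀ t ∈ Icc (0:ℝ) T,
      deriv (fun s => ∑ i, ehat i s • phihat i s) t
        + (ContinuousLinearMap.adjoint (A t)) (∑ i, ehat i t • phihat i t)
      = ∑ i, (deriv (ehat i) t + lam i * ehat i t) • phihat i t := by
    intro t ht
    have hd : HasDerivAt (fun s => ∑ i, ehat i s • phihat i s) _ t :=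
      HasDerivAt.fun_sum fun i _ =>
        ((hehat i).differentiable one_ne_zero t).hasDerivAt.smul (hphi i t ht)
    rw [hd.deriv, map_sum, ← Finset.sum_add_distrib]
    refine Finset.sum_congr rfl fun i _ => ?_
    rw [map_smul]
    module
  have hcongr : ∫ t in (0:ℝ)..T,
        ‖deriv (fun s => ∑ i, ehat i s • phihat i s) t
          + (ContinuousLinearMap.adjoint (A t)) (∑ i, ehat i t • phihat i t)‖ ^ 2
      = ∫ t in (0:ℝ)..T, ‖∑ i, (deriv (ehat i) t + lam i * ehat i t) • phihat i t‖ ^ 2 := by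
    refine intervalIntegral.integral_congr fun t ht => ?_
    rw [uIcc_of_le hT.le] at ht
    simp only [hexpand t ht]
  have hcont : ContinuousOn
      (fun t => ‖∑ i, (deriv (ehat i) t + lam i * ehat i t) • phihat i t‖ ^ 2) (Icc 0 T) := by
    refine (ContinuousOn.norm (continuousOn_finsetSum _ fun i _ => ?_)).pow 2
    exact ((hc' i).add (continuous_const.mul (hc i))).continuousOn.smul (hphic i)
  have hsq : ∀ i, Continuous fun t => (deriv (ehat i) t + lam i * ehat i t) ^ 2 :=
    fun i => ((hc' i).add (continuous_const.mul (hc i))).pow 2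
  rw [hcongr]
  calc ∑ i, cmin * (1 / T ^ 2 + (lam i) ^ 2) * ∫ t in (0:ℝ)..T, (ehat i t) ^ 2
      ≤ ∑ i, cmin * ∫ t in (0:ℝ)..T, (deriv (ehat i) t + lam i * ehat i t) ^ 2 := by
        refine Finset.sum_le_sum fun i _ => ?_
        rw [mul_assoc]
        exact mul_le_mul_of_nonneg_left (integral_sq_le_integral_deriv_add_mul_sq hT.le (lam i)
          (hehat i) (hehat0 i) (hehatT i)) hcmin.le
    _ = ∫ t in (0:ℝ)..T, cmin * ∑ i, (deriv (ehat i) t + lam i * ehat i t) ^ 2 := by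
        rw [intervalIntegral.integral_const_mul, ← Finset.mul_sum,
          intervalIntegral.integral_finsetSum fun i _ => (hsq i).intervalIntegrable 0 T]
    _ ≤ _ := by
        refine intervalIntegral.integral_mono_on hT.le ?_ ?_ fun t ht => hlow _ t ht
        · exact (continuous_const.mul
            (continuous_finsetSum _ fun i _ => hsq i)).intervalIntegrable 0 T
        · exact ContinuousOn.intervalIntegrable_of_Icc hT.le hcont
end

section
/- Let T > 0, α > 0, M ≥ 0, let A : [0,T] → ℝ^{n×n} be continuous with ‖A(t)ᵀ‖ ≤ M for all t, let g : [0,T] → ℝ^n be continuous, and suppose adjoint Lyapunov data (λ_i, φ̂_i, c_min, c_max, n₀) on [0,T] is given. Set Λ² = min_{i ≠ n₀} λ_i² > 0. Then every continuously differentiable e : [0,T] → ℝ^n with e(0) = e(T) = 0 satisfies (1/(2+M)²)·min{ 1/2, c_min/(2c_max T²) + min{ c_min Λ²/(2c_max), 1/(α² c_max) } } · ‖e‖²_{H¹} ≤ B(e,e); in particular γ²‖e‖²_{H¹} ≤ B(e,e), where γ² = (1/(2+M)²)·min{ 1/2, c_min Λ²/(2c_max), 1/(α² c_max) } is independent of T.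 -/
open scoped RealInnerProductSpace
open Set

/-- The `L²` norm of `v` on `[0,T]`: `(∫₀ᵀ ‖v(t)‖² dt)^{1/2}`. -/
noncomputable def L2norm {n : ℕ} (T : ℝ) (v : ℝ → EuclideanSpace ℝ (Fin n)) : ℝ :=
  Real.sqrt (∫ t in (0:ℝ)..T, ‖v t‖ ^ 2)

/-- The `H¹` norm of `v` on `[0,T]`: `(‖v‖₂² + ‖v'‖₂²)^{1/2}`. -/
noncomputable def H1norm {n : ℕ} (T : ℝ) (v : ℝ → EuclideanSpace ℝ (Fin n)) : ℝ :=
  Real.sqrt ((L2norm T v) ^ 2 + (L2norm T (deriv v)) ^ 2)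

/-- The LSS bilinear form
`B(w,v) = ∫₀ᵀ (w'+Aᵀw)·(v'+Aᵀv) dt + (1/α²)∫₀ᵀ (w·g)(v·g) dt`. -/
noncomputable def Bform {n : ℕ} (T α : ℝ)
    (A : ℝ → EuclideanSpace ℝ (Fin n) →L[ℝ] EuclideanSpace ℝ (Fin n))
    (g w v : ℝ → EuclideanSpace ℝ (Fin n)) : ℝ :=
  (∫ t in (0:ℝ)..T, ⟪deriv w t + (ContinuousLinearMap.adjoint (A t)) (w t),
      deriv v t + (ContinuousLinearMap.adjoint (A t)) (v t)⟫)
    + (α ^ 2)⁻¹ * ∫ t in (0:ℝ)..T, ⟪w t, g t⟫ * ⟪v t, g t⟫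

/-- Weighted Poincaré inequality: if `c' = d - l c` on `[0,T]` and `c` vanishes at both ends, then
`(1/T² + l²) ∫ c² ≤ ∫ d²`. -/
theorem integral_sq_le_of_hasDerivAt {T l : ℝ} (hT : 0 < T) {c d : ℝ → ℝ}
    (hc : ∀ t ∈ Icc (0:ℝ) T, HasDerivAt c (d t - l * c t) t)
    (hd : ContinuousOn d (Icc 0 T)) (hc0 : c 0 = 0) (hcT : c T = 0) :
    (1 / T ^ 2 + l ^ 2) * ∫ t in (0:ℝ)..T, c t ^ 2 ≤ ∫ t in (0:ℝ)..T, d t ^ 2 := by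
  have hcc : ContinuousOn c (Icc 0 T) := fun t ht => (hc t ht).continuousAt.continuousWithinAt
  set y : ℝ → ℝ := fun t => T ^ 2 + t * T - t ^ 2 with hy
  have hypos : ∀ t ∈ Icc (0:ℝ) T, 0 < y t := fun t ht => by
    have := mul_nonneg ht.1 (sub_nonneg.2 ht.2)
    simp only [hy]; nlinarith [pow_pos hT 2]
  have hyle : ∀ t ∈ Icc (0:ℝ) T, y t ≤ 2 * T ^ 2 := fun t ht => by
    simp only [hy]; nlinarith [sq_nonneg (t - T / 2), pow_pos hT 2]
  have hyd : ∀ t, HasDerivAt y (T - 2 * t) t := fun t => by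
    have h := (((hasDerivAt_id t).mul_const T).const_add (T ^ 2)).sub (hasDerivAt_pow 2 t)
    refine h.congr_deriv ?_
    simp
  have hyc : Continuous y := by simp only [hy]; fun_prop
  have hnum : ∀ t, HasDerivAt (fun s : ℝ => T - 2 * s) (-2) t := fun t => by
    simpa using ((hasDerivAt_id t).const_mul 2).const_sub T
  set P : ℝ → ℝ := fun t => ((-2) * y t - (T - 2 * t) * (T - 2 * t)) / y t ^ 2 * c t ^ 2
      + (l + (T - 2 * t) / y t) * (2 * c t * (d t - l * c t)) with hP
  have hyne : ∀ t ∈ Icc (0:ℝ) T, y t ≠ 0 := fun t ht => (hypos t ht).ne'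
  have hPc : ContinuousOn P (Icc 0 T) := by
    have h1 : ContinuousOn y (Icc 0 T) := hyc.continuousOn
    have h2 : ContinuousOn (fun t : ℝ => T - 2 * t) (Icc 0 T) := by fun_prop
    have h3 : ∀ t ∈ Icc (0:ℝ) T, y t ^ 2 ≠ 0 := fun t ht => pow_ne_zero 2 (hyne t ht)
    exact (((((continuousOn_const.mul h1).sub (h2.mul h2)).div (h1.pow 2) h3)).mul
      (hcc.pow 2)).add ((continuousOn_const.add (h2.div h1 hyne)).mul
      ((continuousOn_const.mul hcc).mul (hd.sub (continuousOn_const.mul hcc))))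
  have hPd : ∀ t ∈ Icc (0:ℝ) T,
      HasDerivAt (fun s => (l + (T - 2 * s) / y s) * c s ^ 2) (P t) t := fun t ht => by
    have h := (((hnum t).div (hyd t) (hyne t ht)).const_add l).mul ((hc t ht).pow 2)
    refine h.congr_deriv ?_
    simp [hP]
  have hI : ∀ {f : ℝ → ℝ}, ContinuousOn f (Icc 0 T) →
      IntervalIntegrable f MeasureTheory.volume 0 T := fun hf =>
    ContinuousOn.intervalIntegrable (by rwa [uIcc_of_le hT.le])
  have hPint : ∫ t in (0:ℝ)..T, P t = 0 := by
    rw [intervalIntegral.integral_eq_sub_of_hasDerivAt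
      (f := fun s => (l + (T - 2 * s) / y s) * c s ^ 2)
      (by rw [uIcc_of_le hT.le]; exact hPd) (hI hPc)]
    simp [hc0, hcT]
  have key : ∀ t ∈ Icc (0:ℝ) T, (1 / T ^ 2 + l ^ 2) * c t ^ 2 + P t ≤ d t ^ 2 := fun t ht => by
    have e : d t ^ 2 - ((1 / T ^ 2 + l ^ 2) * c t ^ 2 + P t)
        = (d t - l * c t - (T - 2 * t) / y t * c t) ^ 2 + (2 / y t - 1 / T ^ 2) * c t ^ 2 := by
      have := hyne t ht
      simp only [hP]
      field_simp
      ring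
    have h2 : 1 / T ^ 2 ≤ 2 / y t := by
      rw [div_le_div_iff₀ (by positivity) (hypos t ht)]
      linarith [hyle t ht]
    nlinarith [sq_nonneg (d t - l * c t - (T - 2 * t) / y t * c t),
      mul_nonneg (sub_nonneg.2 h2) (sq_nonneg (c t))]
  have hc2 : IntervalIntegrable (fun t => (1 / T ^ 2 + l ^ 2) * c t ^ 2)
      MeasureTheory.volume 0 T := hI (continuousOn_const.mul (hcc.pow 2))
  have hm := intervalIntegral.integral_mono_on hT.le (hc2.add (hI hPc)) (hI (hd.pow 2)) key
  rw [intervalIntegral.integral_add hc2 (hI hPc), intervalIntegral.integral_const_mul, hPint,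
    add_zero] at hm
  exact hm

/-- The linear map `c ↦ ∑ i, c i • v i` spanned by a family of vectors. -/
noncomputable def combCLM {n : ℕ} (v : Fin n → EuclideanSpace ℝ (Fin n)) :
    EuclideanSpace ℝ (Fin n) →L[ℝ] EuclideanSpace ℝ (Fin n) :=
  ∑ i, (EuclideanSpace.proj i : EuclideanSpace ℝ (Fin n) →L[ℝ] ℝ).smulRight (v i)

theorem combCLM_apply {n : ℕ} (v : Fin n → EuclideanSpace ℝ (Fin n))
    (c : EuclideanSpace ℝ (Fin n)) : combCLM v c = ∑ i, c i • v i := by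
  simp [combCLM]

theorem isUnit_combCLM {n : ℕ} {v : Fin n → EuclideanSpace ℝ (Fin n)} {a : ℝ} (ha : 0 < a)
    (h : ∀ c : Fin n → ℝ, a * ∑ i, (c i) ^ 2 ≤ ‖∑ i, c i • v i‖ ^ 2) :
    IsUnit (combCLM v) := by
  have hinj : Function.Injective (combCLM v) := by
    rw [injective_iff_map_eq_zero]
    intro c hc
    have h1 := h c
    rw [← combCLM_apply, hc, norm_zero, zero_pow two_ne_zero,
      ← EuclideanSpace.real_norm_sq_eq] at h1
    have h2 : ‖c‖ ^ 2 ≤ 0 := by nlinarith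
    exact norm_eq_zero.1 (pow_eq_zero_iff two_ne_zero |>.1 (le_antisymm h2 (sq_nonneg _)))
  rw [ContinuousLinearMap.isUnit_iff_bijective]
  exact ⟨hinj, (LinearMap.injective_iff_surjective (f := (combCLM v).toLinearMap)).1 hinj⟩

theorem hasDerivAt_combCLM {n : ℕ} {v : Fin n → ℝ → EuclideanSpace ℝ (Fin n)}
    {v' : Fin n → EuclideanSpace ℝ (Fin n)} {t : ℝ} (h : ∀ i, HasDerivAt (v i) (v' i) t) :
    HasDerivAt (fun s => combCLM fun i => v i s) (combCLM v') t := by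
  unfold combCLM
  refine HasDerivAt.fun_sum fun i _ => ?_
  exact (ContinuousLinearMap.smulRightL ℝ (EuclideanSpace ℝ (Fin n)) (EuclideanSpace ℝ (Fin n))
    (EuclideanSpace.proj i)).hasFDerivAt.comp_hasDerivAt t (h i)

/-- Derivative of the coordinates of `e` in a moving basis `φ i` solving `φ i' = -B φ i + l i φ i`. -/
theorem hasDerivAt_inverse_combCLM {n : ℕ} {φ : Fin n → ℝ → EuclideanSpace ℝ (Fin n)}
    {l : Fin n → ℝ} {B : EuclideanSpace ℝ (Fin n) →L[ℝ] EuclideanSpace ℝ (Fin n)} {t : ℝ}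
    {e : ℝ → EuclideanSpace ℝ (Fin n)} {e' : EuclideanSpace ℝ (Fin n)}
    (hφ : ∀ i, HasDerivAt (φ i) (-B (φ i t) + l i • φ i t) t)
    (hu : IsUnit (combCLM fun i => φ i t)) (he : HasDerivAt e e' t) (j : Fin n) :
    HasDerivAt (fun s => Ring.inverse (combCLM fun i => φ i s) (e s) j)
      (Ring.inverse (combCLM fun i => φ i t) (e' + B (e t)) j
        - l j * Ring.inverse (combCLM fun i => φ i t) (e t) j) t := by
  obtain ⟨u, hu⟩ := hu
  set Φ : ℝ → EuclideanSpace ℝ (Fin n) →L[ℝ] EuclideanSpace ℝ (Fin n) :=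
    fun s => combCLM fun i => φ i s with hΦdef
  have hΦ : HasDerivAt Φ (combCLM fun i => -B (φ i t) + l i • φ i t) t := hasDerivAt_combCLM hφ
  have hut : (u : EuclideanSpace ℝ (Fin n) →L[ℝ] EuclideanSpace ℝ (Fin n)) = Φ t := hu
  have hinv := hasFDerivAt_ringInverse (𝕜 := ℝ) u
  rw [hut] at hinv
  have huΦ : IsUnit (Φ t) := hut ▸ u.isUnit
  have hleft : ∀ x, Ring.inverse (Φ t) (Φ t x) = x := fun x =>
    DFunLike.congr_fun (Ring.inverse_mul_cancel _ huΦ) x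
  have hright : ∀ x, Φ t (Ring.inverse (Φ t) x) = x := fun x =>
    DFunLike.congr_fun (Ring.mul_inverse_cancel _ huΦ) x
  have hcomb : ∀ x, combCLM (fun i => -B (φ i t) + l i • φ i t) x
      = -B (Φ t x) + Φ t (WithLp.toLp 2 fun i => l i * x i) := fun x => by
    simp only [hΦdef, combCLM_apply, map_sum, map_smul, smul_add, Finset.sum_add_distrib, smul_neg,
      Finset.sum_neg_distrib, smul_smul, mul_comm]
  have huinv : (↑u⁻¹ : EuclideanSpace ℝ (Fin n) →L[ℝ] EuclideanSpace ℝ (Fin n))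
      = Ring.inverse (Φ t) := by rw [← hut, Ring.inverse_unit]
  have hΨ : HasDerivAt (fun s => Ring.inverse (Φ s)) (-(Ring.inverse (Φ t)
      * (combCLM fun i => -B (φ i t) + l i • φ i t) * Ring.inverse (Φ t))) t := by
    have h := hinv.comp_hasDerivAt t hΦ
    rw [huinv] at h
    exact h
  have hval : -(Ring.inverse (Φ t) (combCLM (fun i => -B (φ i t) + l i • φ i t)
        (Ring.inverse (Φ t) (e t))))
      = Ring.inverse (Φ t) (B (e t))
        - WithLp.toLp 2 fun i => l i * Ring.inverse (Φ t) (e t) i := by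
    rw [hcomb, hright, map_add, hleft, map_neg]
    abel
  have hj := (EuclideanSpace.proj j : EuclideanSpace ℝ (Fin n) →L[ℝ] ℝ).hasFDerivAt.comp_hasDerivAt
    t (hΨ.clm_apply he)
  refine hj.congr_deriv ?_
  change (-(Ring.inverse (Φ t) (combCLM (fun i => -B (φ i t) + l i • φ i t)
    (Ring.inverse (Φ t) (e t)))) + Ring.inverse (Φ t) e') j = _
  rw [hval, map_add]
  simp only [PiLp.add_apply, PiLp.sub_apply]
  ring

/-- The `H¹` norm is controlled by `‖e‖₂` and `‖e' + B e‖₂` when `‖B‖ ≤ M`. -/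
theorem H1norm_sq_le {n : ℕ} {T M : ℝ} (hT : 0 < T) (hM : 0 ≤ M)
    {B : ℝ → EuclideanSpace ℝ (Fin n) →L[ℝ] EuclideanSpace ℝ (Fin n)}
    (hBc : ContinuousOn B (Icc 0 T)) (hB : ∀ t ∈ Icc (0:ℝ) T, ‖B t‖ ≤ M)
    {e : ℝ → EuclideanSpace ℝ (Fin n)} (he : ContDiff ℝ 1 e) :
    H1norm T e ^ 2 ≤ (2 + M) ^ 2 * ((∫ t in (0:ℝ)..T, ‖deriv e t + B t (e t)‖ ^ 2)
      + ∫ t in (0:ℝ)..T, ‖e t‖ ^ 2) := by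
  have hI : ∀ {v : ℝ → EuclideanSpace ℝ (Fin n)}, ContinuousOn v (Icc 0 T) →
      IntervalIntegrable (fun t => ‖v t‖ ^ 2) MeasureTheory.volume 0 T := fun hv =>
    ContinuousOn.intervalIntegrable (by rw [uIcc_of_le hT.le]; exact hv.norm.pow 2)
  have hec : ContinuousOn e (Icc 0 T) := he.continuous.continuousOn
  have hec' : ContinuousOn (deriv e) (Icc 0 T) := (he.continuous_deriv le_rfl).continuousOn
  have he2 := hI hec
  have he2' := hI hec'
  have hf2 := hI (v := fun t => deriv e t + B t (e t)) (hec'.add (hBc.clm_apply hec))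
  have h0 : ∀ v : ℝ → EuclideanSpace ℝ (Fin n), 0 ≤ ∫ t in (0:ℝ)..T, ‖v t‖ ^ 2 := fun v =>
    intervalIntegral.integral_nonneg hT.le fun t _ => sq_nonneg _
  unfold H1norm L2norm
  rw [Real.sq_sqrt (by positivity), Real.sq_sqrt (h0 _), Real.sq_sqrt (h0 _),
    ← intervalIntegral.integral_add he2 he2', ← intervalIntegral.integral_add hf2 he2,
    ← intervalIntegral.integral_const_mul]
  refine intervalIntegral.integral_mono_on hT.le (he2.add he2')
    ((hf2.add he2).const_mul _) fun t ht => ?_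
  have h1 : ‖deriv e t‖ ≤ ‖deriv e t + B t (e t)‖ + M * ‖e t‖ := by
    have h2 : deriv e t = (deriv e t + B t (e t)) - B t (e t) := by abel
    calc ‖deriv e t‖ = ‖(deriv e t + B t (e t)) - B t (e t)‖ := by rw [← h2]
      _ ≤ ‖deriv e t + B t (e t)‖ + ‖B t (e t)‖ := norm_sub_le _ _
      _ ≤ _ := by gcongr; exact (B t).le_of_opNorm_le (hB t ht) _
  generalize ‖deriv e t + B t (e t)‖ = a at h1 ⊢
  have h4 : ‖deriv e t‖ ^ 2 ≤ (a + M * ‖e t‖) ^ 2 := by gcongr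
  nlinarith [sq_nonneg (M * a - ‖e t‖), mul_nonneg hM (sq_nonneg a),
    mul_nonneg hM (sq_nonneg ‖e t‖), sq_nonneg a, sq_nonneg ‖e t‖]

/-- Combines the coordinatewise lower bound on `F` with the upper bound on `N`. -/
theorem const_mul_le_half_add {ι : Type*} [Fintype ι] [DecidableEq ι]
    {T α cmin cmax Λsq F N : ℝ} {lam S : ι → ℝ} {n₀ : ι} (hT : 0 < T) (hα : 0 < α)
    (hcmin : 0 < cmin) (hcmax : 0 < cmax) (hΛ0 : 0 ≤ Λsq) (hΛ : ∀ i, i ≠ n₀ → Λsq ≤ lam i ^ 2)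
    (hS0 : ∀ i, 0 ≤ S i) (hFlow : cmin * ∑ i, (1 / T ^ 2 + lam i ^ 2) * S i ≤ F)
    (hNle : N ≤ cmax * ∑ i, S i) :
    (cmin / (2 * cmax * T ^ 2) + min (cmin * Λsq / (2 * cmax)) (1 / (α ^ 2 * cmax))) * N
      ≤ F / 2 + (α ^ 2)⁻¹ * S n₀ := by
  set m₀ : ℝ := min (cmin * Λsq / (2 * cmax)) (1 / (α ^ 2 * cmax)) with hm₀
  have hm₀0 : 0 ≤ m₀ := le_min (by positivity) (by positivity)
  have hterm : ∀ i, cmax * (cmin / (2 * cmax * T ^ 2) + m₀) * S i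
      ≤ cmin / 2 * ((1 / T ^ 2 + lam i ^ 2) * S i) + if i = n₀ then (α ^ 2)⁻¹ * S i else 0 := by
    intro i
    have e1 : cmax * (cmin / (2 * cmax * T ^ 2)) = cmin / 2 * (1 / T ^ 2) := by field_simp
    split_ifs with hi
    · have h1 : cmax * m₀ ≤ (α ^ 2)⁻¹ := by
        refine (mul_le_mul_of_nonneg_left (min_le_right _ _) hcmax.le).trans_eq ?_
        field_simp
      have h2 := mul_le_mul_of_nonneg_right h1 (hS0 i)
      have h3 : 0 ≤ cmin / 2 * (lam i ^ 2 * S i) :=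
        mul_nonneg (by positivity) (mul_nonneg (sq_nonneg _) (hS0 i))
      rw [mul_add, e1]
      nlinarith
    · have h1 : cmax * m₀ ≤ cmin / 2 * lam i ^ 2 := by
        refine (mul_le_mul_of_nonneg_left (min_le_left _ _) hcmax.le).trans ?_
        have h2 : Λsq ≤ lam i ^ 2 := hΛ i hi
        calc cmax * (cmin * Λsq / (2 * cmax)) = cmin / 2 * Λsq := by field_simp
          _ ≤ _ := by gcongr
      have h2 := mul_le_mul_of_nonneg_right h1 (hS0 i)
      rw [mul_add, e1]
      nlinarith
  have h1 := Finset.sum_le_sum fun i (_ : i ∈ Finset.univ) => hterm i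
  rw [← Finset.mul_sum, Finset.sum_add_distrib, ← Finset.mul_sum,
    Finset.sum_ite_eq' Finset.univ n₀, if_pos (Finset.mem_univ _)] at h1
  have h2 := mul_le_mul_of_nonneg_left hNle
    (a := cmin / (2 * cmax * T ^ 2) + m₀) (by positivity)
  linarith

/-- **Coercivity of the LSS bilinear form, with a `T`-independent constant.**
Under uniform hyperbolicity (adjoint Lyapunov data), every continuously differentiable
`e` with `e(0) = e(T) = 0` satisfies
`(1/(2+M)²)·min{1/2, c_min/(2c_maxT²) + min{c_minΛ²/(2c_max), 1/(α²c_max)}}·‖e‖²_{H¹} ≤ B(e,e)`,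
and in particular `γ²‖e‖²_{H¹} ≤ B(e,e)` with
`γ² = (1/(2+M)²)·min{1/2, c_minΛ²/(2c_max), 1/(α²c_max)}` independent of `T`. -/
theorem lss_bilinear_coercive
    (n : ℕ) (T α M : ℝ) (hT : 0 < T) (hα : 0 < α) (hM : 0 ≤ M)
    (A : ℝ → EuclideanSpace ℝ (Fin n) →L[ℝ] EuclideanSpace ℝ (Fin n))
    (hA : ContinuousOn A (Icc 0 T))
    (hAbd : ∀ t ∈ Icc (0:ℝ) T, ‖ContinuousLinearMap.adjoint (A t)‖ ≤ M)
    (g : ℝ → EuclideanSpace ℝ (Fin n)) (hg : ContinuousOn g (Icc 0 T))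
    -- adjoint Lyapunov data
    (lam : Fin n → ℝ) (phihat : Fin n → ℝ → EuclideanSpace ℝ (Fin n))
    (hphi : ∀ i, ∀ t ∈ Icc (0:ℝ) T,
      HasDerivAt (phihat i)
        (-(ContinuousLinearMap.adjoint (A t)) (phihat i t) + lam i • phihat i t) t)
    (cmin cmax : ℝ) (hcmin : 0 < cmin) (hcc : cmin ≤ cmax)
    (hlow : ∀ (c : Fin n → ℝ), ∀ t ∈ Icc (0:ℝ) T,
      cmin * ∑ i, (c i) ^ 2 ≤ ‖∑ i, c i • phihat i t‖ ^ 2)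
    (hhigh : ∀ (c : Fin n → ℝ), ∀ t ∈ Icc (0:ℝ) T,
      ‖∑ i, c i • phihat i t‖ ^ 2 ≤ cmax * ∑ i, (c i) ^ 2)
    (n₀ : Fin n) (hlam0 : lam n₀ = 0) (hlamne : ∀ i, i ≠ n₀ → lam i ≠ 0)
    (horth : ∀ i, ∀ t ∈ Icc (0:ℝ) T,
      ⟪phihat i t, g t⟫ = if i = n₀ then 1 else 0)
    -- Λ² = min_{i ≠ n₀} λᵢ²  (> 0 since λᵢ ≠ 0 for i ≠ n₀)
    (Λsq : ℝ) (hΛ : IsLeast {x : ℝ | ∃ i, i ≠ n₀ ∧ x = (lam i) ^ 2} Λsq)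
    -- the test function
    (e : ℝ → EuclideanSpace ℝ (Fin n)) (he : ContDiff ℝ 1 e)
    (he0 : e 0 = 0) (heT : e T = 0) :
    (1 / (2 + M) ^ 2)
        * min (1 / 2)
            (cmin / (2 * cmax * T ^ 2)
              + min (cmin * Λsq / (2 * cmax)) (1 / (α ^ 2 * cmax)))
        * (H1norm T e) ^ 2 ≤ Bform T α A g e e
      ∧ (1 / (2 + M) ^ 2)
          * min (1 / 2) (min (cmin * Λsq / (2 * cmax)) (1 / (α ^ 2 * cmax)))
          * (H1norm T e) ^ 2 ≤ Bform T α A g e e := by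
  have hcmax : 0 < cmax := hcmin.trans_le hcc
  have hI : ∀ {f : ℝ → ℝ}, ContinuousOn f (Icc 0 T) →
      IntervalIntegrable f MeasureTheory.volume 0 T := fun hf =>
    ContinuousOn.intervalIntegrable (by rwa [uIcc_of_le hT.le])
  have hec : ContinuousOn e (Icc 0 T) := he.continuous.continuousOn
  have hec' : ContinuousOn (deriv e) (Icc 0 T) := (he.continuous_deriv le_rfl).continuousOn
  set B : ℝ → EuclideanSpace ℝ (Fin n) →L[ℝ] EuclideanSpace ℝ (Fin n) :=
    fun t => ContinuousLinearMap.adjoint (A t) with hB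
  have hBc : ContinuousOn B (Icc 0 T) :=
    (ContinuousLinearMap.adjoint (𝕜 := ℝ) (E := EuclideanSpace ℝ (Fin n))
      (F := EuclideanSpace ℝ (Fin n))).continuous.comp_continuousOn hA
  set f : ℝ → EuclideanSpace ℝ (Fin n) := fun t => deriv e t + B t (e t) with hf
  have hfc : ContinuousOn f (Icc 0 T) := hec'.add (hBc.clm_apply hec)
  set Ψ : ℝ → EuclideanSpace ℝ (Fin n) →L[ℝ] EuclideanSpace ℝ (Fin n) :=
    fun t => Ring.inverse (combCLM fun i => phihat i t) with hΨ
  have hunit : ∀ t ∈ Icc (0:ℝ) T, IsUnit (combCLM fun i => phihat i t) := fun t ht =>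
    isUnit_combCLM hcmin fun c => hlow c t ht
  have hsum : ∀ t ∈ Icc (0:ℝ) T, ∀ x, ∑ i, Ψ t x i • phihat i t = x := fun t ht x => by
    rw [← combCLM_apply]
    exact DFunLike.congr_fun (Ring.mul_inverse_cancel _ (hunit t ht)) x
  have hΨc : ContinuousOn Ψ (Icc 0 T) := fun t ht => by
    obtain ⟨u, hu⟩ := hunit t ht
    have h1 := (hasFDerivAt_ringInverse (𝕜 := ℝ) u).continuousAt
    rw [hu] at h1
    exact (h1.comp (f := fun s => combCLM fun i => phihat i s)
      (hasDerivAt_combCLM fun i => hphi i t ht).continuousAt).continuousWithinAt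
  set c : Fin n → ℝ → ℝ := fun i t => Ψ t (e t) i with hc
  set d : Fin n → ℝ → ℝ := fun i t => Ψ t (f t) i with hd
  have hcoord : ∀ {v : ℝ → EuclideanSpace ℝ (Fin n)} (i : Fin n), ContinuousOn v (Icc 0 T) →
      ContinuousOn (fun t => Ψ t (v t) i) (Icc 0 T) := fun i hv =>
    (EuclideanSpace.proj (𝕜 := ℝ) i).continuous.comp_continuousOn (hΨc.clm_apply hv)
  have hcc' : ∀ i, ContinuousOn (c i) (Icc 0 T) := fun i => hcoord i hec
  have hdc : ∀ i, ContinuousOn (d i) (Icc 0 T) := fun i => hcoord i hfc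
  have hcd : ∀ i, ∀ t ∈ Icc (0:ℝ) T, HasDerivAt (c i) (d i t - lam i * c i t) t :=
    fun i t ht => hasDerivAt_inverse_combCLM (B := B t) (fun j => hphi j t ht) (hunit t ht)
      (he.differentiable one_ne_zero t).hasDerivAt i
  have hpoin : ∀ i, (1 / T ^ 2 + lam i ^ 2) * ∫ t in (0:ℝ)..T, c i t ^ 2
      ≤ ∫ t in (0:ℝ)..T, d i t ^ 2 := fun i =>
    integral_sq_le_of_hasDerivAt hT (hcd i) (hdc i) (by simp [hc, he0]) (by simp [hc, heT])
  have hc2 : ∀ i, IntervalIntegrable (fun t => c i t ^ 2) MeasureTheory.volume 0 T :=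
    fun i => hI ((hcc' i).pow 2)
  have hd2 : ∀ i, IntervalIntegrable (fun t => d i t ^ 2) MeasureTheory.volume 0 T :=
    fun i => hI ((hdc i).pow 2)
  have hf2 : IntervalIntegrable (fun t => ‖f t‖ ^ 2) MeasureTheory.volume 0 T :=
    hI (hfc.norm.pow 2)
  have he2 : IntervalIntegrable (fun t => ‖e t‖ ^ 2) MeasureTheory.volume 0 T :=
    hI (hec.norm.pow 2)
  set S : Fin n → ℝ := fun i => ∫ t in (0:ℝ)..T, c i t ^ 2 with hS
  set F : ℝ := ∫ t in (0:ℝ)..T, ‖f t‖ ^ 2 with hF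
  set N : ℝ := ∫ t in (0:ℝ)..T, ‖e t‖ ^ 2 with hN
  have hS0 : ∀ i, 0 ≤ S i := fun i =>
    intervalIntegral.integral_nonneg hT.le fun t _ => sq_nonneg _
  have hF0 : 0 ≤ F := intervalIntegral.integral_nonneg hT.le fun t _ => sq_nonneg _
  have hN0 : 0 ≤ N := intervalIntegral.integral_nonneg hT.le fun t _ => sq_nonneg _
  have hFlow : cmin * ∑ i, (1 / T ^ 2 + lam i ^ 2) * S i ≤ F := by
    have h1 : cmin * ∑ i, ∫ t in (0:ℝ)..T, d i t ^ 2 ≤ F := by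
      rw [← intervalIntegral.integral_finsetSum fun i _ => hd2 i,
        ← intervalIntegral.integral_const_mul]
      refine intervalIntegral.integral_mono_on hT.le
        (hI (continuousOn_const.mul (continuousOn_finsetSum _ fun i _ => (hdc i).pow 2))) hf2
        fun t ht => ?_
      have h := hlow (fun i => d i t) t ht
      rwa [hsum t ht] at h
    exact (mul_le_mul_of_nonneg_left (Finset.sum_le_sum fun i _ => hpoin i) hcmin.le).trans h1
  have hNle : N ≤ cmax * ∑ i, S i := by
    rw [hS, ← intervalIntegral.integral_finsetSum fun i _ => hc2 i,
      ← intervalIntegral.integral_const_mul]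
    refine intervalIntegral.integral_mono_on hT.le he2
      (hI (continuousOn_const.mul (continuousOn_finsetSum _ fun i _ => (hcc' i).pow 2)))
      fun t ht => ?_
    have h := hhigh (fun i => c i t) t ht
    rwa [hsum t ht] at h
  have hBform : Bform T α A g e e = F + (α ^ 2)⁻¹ * S n₀ := by
    unfold Bform
    congr 1
    · refine intervalIntegral.integral_congr fun t _ => ?_
      exact real_inner_self_eq_norm_sq _
    · congr 1
      refine intervalIntegral.integral_congr fun t ht => ?_
      rw [uIcc_of_le hT.le] at ht
      have h : ⟪e t, g t⟫ = c n₀ t := by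
        conv_lhs => rw [← hsum t ht (e t)]
        simp [sum_inner, inner_smul_left, horth _ t ht, hc]
      change ⟪e t, g t⟫ * ⟪e t, g t⟫ = c n₀ t ^ 2
      rw [h, sq]
  have hH : H1norm T e ^ 2 ≤ (2 + M) ^ 2 * (F + N) := H1norm_sq_le hT hM hBc hAbd he
  set m₀ : ℝ := min (cmin * Λsq / (2 * cmax)) (1 / (α ^ 2 * cmax)) with hm₀
  have hΛ0 : 0 ≤ Λsq := by
    obtain ⟨i, _, hi⟩ := hΛ.1
    rw [hi]; positivity
  have hm₀0 : 0 ≤ m₀ := le_min (by positivity) (by positivity)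
  have hκ : (cmin / (2 * cmax * T ^ 2) + m₀) * N ≤ F / 2 + (α ^ 2)⁻¹ * S n₀ :=
    const_mul_le_half_add hT hα hcmin hcmax hΛ0 (fun i hi => hΛ.2 ⟨i, hi, rfl⟩) hS0 hFlow hNle
  have hmain : ∀ m : ℝ, 0 ≤ m → m ≤ 1 / 2 → m ≤ cmin / (2 * cmax * T ^ 2) + m₀ →
      1 / (2 + M) ^ 2 * m * H1norm T e ^ 2 ≤ Bform T α A g e e := by
    intro m h0 h1 h2
    rw [hBform]
    calc 1 / (2 + M) ^ 2 * m * H1norm T e ^ 2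
        ≤ 1 / (2 + M) ^ 2 * m * ((2 + M) ^ 2 * (F + N)) := by gcongr
      _ = m * F + m * N := by field_simp
      _ ≤ 1 / 2 * F + (cmin / (2 * cmax * T ^ 2) + m₀) * N := by gcongr
      _ ≤ F + (α ^ 2)⁻¹ * S n₀ := by linarith
  have hpos : 0 ≤ cmin / (2 * cmax * T ^ 2) := by positivity
  exact ⟨hmain _ (le_min (by norm_num) (by positivity)) (min_le_left _ _) (min_le_right _ _),
    hmain _ (le_min (by norm_num) hm₀0) (min_le_left _ _)
      ((min_le_right _ _).trans (le_add_of_nonneg_left hpos))⟩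
end

section
/- Let T > 0, α > 0, let A : [0,T] → ℝ^{n×n} be continuously differentiable, g : [0,T] → ℝ^n continuous, and let e : [0,T] → ℝ^n be twice continuously differentiable with e(0) = e(T) = 0. Then ∫₀ᵀ e(t)·(ℒe)(t) dt = ∫₀ᵀ ‖e'(t) + A(t)ᵀe(t)‖² dt + (1/α²) ∫₀ᵀ (e(t)·g(t))² dt. -/
open scoped RealInnerProductSpace
open Set

/-- The least-squares shadowing (LSS) operator
`(ℒe)(t) = −e''(t) − (d/dt)(A(t)ᵀe(t)) + A(t)e'(t) + A(t)A(t)ᵀe(t) + (1/α²)(g(t)·e(t))g(t)`. -/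
noncomputable def LSSop {n : ℕ} (α : ℝ)
    (A : ℝ → EuclideanSpace ℝ (Fin n) →L[ℝ] EuclideanSpace ℝ (Fin n))
    (g e : ℝ → EuclideanSpace ℝ (Fin n)) : ℝ → EuclideanSpace ℝ (Fin n) :=
  fun t =>
    -(deriv (deriv e) t)
      - deriv (fun s => (ContinuousLinearMap.adjoint (A s)) (e s)) t
      + (A t) (deriv e t)
      + (A t) ((ContinuousLinearMap.adjoint (A t)) (e t))
      + (α ^ 2)⁻¹ • (⟪g t, e t⟫ • g t)

/-- Over the reals, taking adjoints preserves continuous differentiability. -/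
theorem ContDiff.clm_adjoint_real {E F G : Type*} {k : WithTop ℕ∞}
    [NormedAddCommGroup E] [InnerProductSpace ℝ E] [CompleteSpace E]
    [NormedAddCommGroup F] [InnerProductSpace ℝ F] [CompleteSpace F]
    [NormedAddCommGroup G] [NormedSpace ℝ G]
    {A : G → E →L[ℝ] F} (hA : ContDiff ℝ k A) :
    ContDiff ℝ k fun x => ContinuousLinearMap.adjoint (A x) := by
  let adj : (E →L[ℝ] F) →L[ℝ] (F →L[ℝ] E) :=
    { toFun := fun M => ContinuousLinearMap.adjoint M
      map_add' := fun M N => map_add _ M N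
      map_smul' := fun c M => by simp
      cont := ContinuousLinearMap.adjoint.continuous }
  exact adj.contDiff.comp hA

/-- Pointwise form of the integration by parts: `e·ℒe` is the sum of squares minus the derivative
of `e·(e' + Aᵀe)`. -/
theorem inner_LSSop {n : ℕ} (α : ℝ)
    (A : ℝ → EuclideanSpace ℝ (Fin n) →L[ℝ] EuclideanSpace ℝ (Fin n))
    (g e : ℝ → EuclideanSpace ℝ (Fin n)) (t : ℝ)
    (hde : DifferentiableAt ℝ (deriv e) t)
    (hAe : DifferentiableAt ℝ (fun s => ContinuousLinearMap.adjoint (A s) (e s)) t) :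
    ⟪e t, LSSop α A g e t⟫
      = ‖deriv e t + ContinuousLinearMap.adjoint (A t) (e t)‖ ^ 2
        + (α ^ 2)⁻¹ * ⟪e t, g t⟫ ^ 2
        - (⟪e t, deriv (fun s => deriv e s + ContinuousLinearMap.adjoint (A s) (e s)) t⟫
          + ⟪deriv e t, deriv e t + ContinuousLinearMap.adjoint (A t) (e t)⟫) := by
  rw [deriv_fun_add hde hAe, ← real_inner_self_eq_norm_sq]
  simp only [LSSop, inner_add_right, inner_add_left, inner_sub_right, inner_neg_right,
    inner_smul_right, ContinuousLinearMap.adjoint_inner_left, real_inner_comm (e t) (g t)]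
  ring

/-- **Integration by parts for the LSS operator:** for `e` twice continuously
differentiable with `e(0) = e(T) = 0`,
`∫₀ᵀ e·(ℒe) dt = ∫₀ᵀ ‖e' + Aᵀe‖² dt + (1/α²)∫₀ᵀ (e·g)² dt`. -/
theorem lss_integration_by_parts
    (n : ℕ) (T α : ℝ) (hT : 0 < T) (hα : 0 < α)
    (A : ℝ → EuclideanSpace ℝ (Fin n) →L[ℝ] EuclideanSpace ℝ (Fin n))
    (hA : ContDiff ℝ 1 A)
    (g : ℝ → EuclideanSpace ℝ (Fin n)) (hg : Continuous g)
    (e : ℝ → EuclideanSpace ℝ (Fin n)) (he : ContDiff ℝ 2 e)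
    (he0 : e 0 = 0) (heT : e T = 0) :
    ∫ t in (0:ℝ)..T, ⟪e t, LSSop α A g e t⟫
      = (∫ t in (0:ℝ)..T,
          ‖deriv e t + (ContinuousLinearMap.adjoint (A t)) (e t)‖ ^ 2)
        + (α ^ 2)⁻¹ * ∫ t in (0:ℝ)..T, ⟪e t, g t⟫ ^ 2 := by
  have hde : ContDiff ℝ 1 (deriv e) := he.deriv'
  have hAe : ContDiff ℝ 1 fun s => ContinuousLinearMap.adjoint (A s) (e s) :=
    hA.clm_adjoint_real.clm_apply (he.of_le one_le_two)
  set w : ℝ → EuclideanSpace ℝ (Fin n) :=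
    fun s => deriv e s + ContinuousLinearMap.adjoint (A s) (e s)
  have hw : ContDiff ℝ 1 w := hde.add hAe
  have hw' : Continuous (deriv w) := hw.continuous_deriv le_rfl
  have hec : Continuous e := he.continuous
  have hwc : Continuous w := hw.continuous
  have hdec : Continuous (deriv e) := hde.continuous
  have hderiv : ∀ t, HasDerivAt (fun s => ⟪e s, w s⟫)
      (⟪e t, deriv w t⟫ + ⟪deriv e t, w t⟫) t := fun t =>
    ((he.differentiable two_ne_zero) t).hasDerivAt.inner ℝ
      ((hw.differentiable one_ne_zero) t).hasDerivAt
  have hboundary : ∫ t in (0:ℝ)..T, (⟪e t, deriv w t⟫ + ⟪deriv e t, w t⟫) = 0 := by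
    rw [intervalIntegral.integral_eq_sub_of_hasDerivAt (fun t _ => hderiv t)
      (Continuous.intervalIntegrable (by fun_prop) _ _)]
    simp [he0, heT]
  have hpoint : ∀ t, ⟪e t, LSSop α A g e t⟫ = ‖w t‖ ^ 2 + (α ^ 2)⁻¹ * ⟪e t, g t⟫ ^ 2
      - (⟪e t, deriv w t⟫ + ⟪deriv e t, w t⟫) := fun t =>
    inner_LSSop α A g e t (hde.differentiable one_ne_zero t) (hAe.differentiable one_ne_zero t)
  simp_rw [hpoint]
  rw [intervalIntegral.integral_sub (Continuous.intervalIntegrable (by fun_prop) _ _)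
      (Continuous.intervalIntegrable (by fun_prop) _ _), hboundary, sub_zero,
    intervalIntegral.integral_add (Continuous.intervalIntegrable (by fun_prop) _ _)
      (Continuous.intervalIntegrable (by fun_prop) _ _), intervalIntegral.integral_const_mul]
end

section
/- Let T > 0, α > 0, M ≥ 0, let A : [0,T] → ℝ^{n×n} be continuously differentiable with ‖A(t)ᵀ‖ ≤ M for all t, let g : [0,T] → ℝ^n be continuous, and suppose adjoint Lyapunov data (λ_i, φ̂_i, c_min, c_max, n₀) on [0,T] is given. Set γ² = (1/(2+M)²)·min{ 1/2, c_min Λ²/(2c_max), 1/(α² c_max) } with Λ² = min_{i ≠ n₀} λ_i². If e : [0,T] → ℝ^n is twice continuously differentiable with e(0) = e(T) = 0 and (ℒe)(t) = w(t) for a continuous w : [0,T] → ℝ^n, then γ²‖e‖_{H¹} ≤ ‖w‖₂. -/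
open scoped RealInnerProductSpace
open Set

section Frames

variable {n : ℕ}

/-- The operator sending the coordinates `c` to `∑ i, c i • v i`. -/
noncomputable def frameMap (v : Fin n → EuclideanSpace ℝ (Fin n)) :
    EuclideanSpace ℝ (Fin n) →L[ℝ] EuclideanSpace ℝ (Fin n) :=
  ∑ i, (EuclideanSpace.proj i : EuclideanSpace ℝ (Fin n) →L[ℝ] ℝ).smulRight (v i)

lemma frameMap_apply (v : Fin n → EuclideanSpace ℝ (Fin n)) (c : EuclideanSpace ℝ (Fin n)) :
    frameMap v c = ∑ i, c i • v i := by
  simp [frameMap]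

lemma hasDerivAt_frameMap {v : Fin n → ℝ → EuclideanSpace ℝ (Fin n)}
    {v' : Fin n → EuclideanSpace ℝ (Fin n)} {t : ℝ} (hv : ∀ i, HasDerivAt (v i) (v' i) t) :
    HasDerivAt (fun s => frameMap fun i => v i s) (frameMap v') t := by
  unfold frameMap
  refine HasDerivAt.fun_sum fun i _ => ?_
  exact ((ContinuousLinearMap.smulRightL ℝ (EuclideanSpace ℝ (Fin n)) (EuclideanSpace ℝ (Fin n))
    (EuclideanSpace.proj i)).hasFDerivAt.comp_hasDerivAt t (hv i))

lemma isUnit_frameMap {v : Fin n → EuclideanSpace ℝ (Fin n)} {a : ℝ} (ha : 0 < a)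
    (hlow : ∀ c : Fin n → ℝ, a * ∑ i, (c i) ^ 2 ≤ ‖∑ i, c i • v i‖ ^ 2) :
    IsUnit (frameMap v) := by
  rw [ContinuousLinearMap.isUnit_iff_bijective]
  have hinj : Function.Injective (frameMap v) := by
    rw [injective_iff_map_eq_zero]
    intro c hc
    have h := hlow c
    rw [← frameMap_apply, hc, ← EuclideanSpace.real_norm_sq_eq] at h
    have : ‖c‖ ^ 2 ≤ 0 := by
      by_contra! hpos
      nlinarith [mul_pos ha hpos, norm_zero (E := EuclideanSpace ℝ (Fin n))]
    simpa using this
  exact ⟨hinj, LinearMap.injective_iff_surjective (f := (frameMap v).toLinearMap).1 hinj⟩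

lemma hasDerivAt_inverse_apply {E : Type*} [NormedAddCommGroup E] [NormedSpace ℝ E]
    [CompleteSpace E] {B : ℝ → E →L[ℝ] E} {B' : E →L[ℝ] E} {e : ℝ → E} {e' : E} {t : ℝ}
    (hu : IsUnit (B t)) (hB : HasDerivAt B B' t) (he : HasDerivAt e e' t) :
    HasDerivAt (fun s => Ring.inverse (B s) (e s))
      (Ring.inverse (B t) (e' - B' (Ring.inverse (B t) (e t)))) t := by
  obtain ⟨u, hu⟩ := hu
  have h1 : HasFDerivAt Ring.inverse _ (B t) := hu ▸ hasFDerivAt_ringInverse (𝕜 := ℝ) u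
  refine ((h1.comp_hasDerivAt t hB).clm_apply he).congr_deriv ?_
  simp [← hu, sub_eq_neg_add]

/-- Coordinates of `e` in a frame solving `φ' = -Bφ + λφ` satisfy decoupled scalar equations
driven by the coordinates of `e' + Be`. -/
lemma hasDerivAt_frame_coord {φ : Fin n → ℝ → EuclideanSpace ℝ (Fin n)} {lam : Fin n → ℝ}
    {B : EuclideanSpace ℝ (Fin n) →L[ℝ] EuclideanSpace ℝ (Fin n)}
    {e : ℝ → EuclideanSpace ℝ (Fin n)} {e' : EuclideanSpace ℝ (Fin n)} {t : ℝ}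
    (hu : IsUnit (frameMap fun i => φ i t))
    (hφ : ∀ i, HasDerivAt (φ i) (-B (φ i t) + lam i • φ i t) t) (he : HasDerivAt e e' t)
    (i : Fin n) :
    HasDerivAt (fun s => Ring.inverse (frameMap fun i => φ i s) (e s) i)
      (Ring.inverse (frameMap fun i => φ i t) (e' + B (e t)) i
        - lam i * Ring.inverse (frameMap fun i => φ i t) (e t) i) t := by
  have h := hasDerivAt_inverse_apply hu (hasDerivAt_frameMap hφ) he
  have hi := (EuclideanSpace.proj i : EuclideanSpace ℝ (Fin n) →L[ℝ] ℝ).hasFDerivAt.comp_hasDerivAt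
    t h
  refine hi.congr_deriv ?_
  set F := frameMap fun i => φ i t with hF
  set c := Ring.inverse F (e t) with hc
  have hFc : F c = e t := by
    have := congrArg (fun L => L (e t)) (Ring.mul_inverse_cancel F hu)
    simpa using this
  set l : EuclideanSpace ℝ (Fin n) := WithLp.toLp 2 fun i => lam i * c i with hl
  have hsplit : frameMap (fun i => -B (φ i t) + lam i • φ i t) c = -B (e t) + F l := by
    rw [← hFc, hF, frameMap_apply, frameMap_apply, frameMap_apply, map_sum,
      ← Finset.sum_neg_distrib, ← Finset.sum_add_distrib]
    refine Finset.sum_congr rfl fun j _ => ?_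
    simp [hl, smul_smul, mul_comm]
  have hFl : Ring.inverse F (F l) = l := by
    have := congrArg (fun L => L l) (Ring.inverse_mul_cancel F hu)
    simpa using this
  rw [hsplit, sub_add_eq_sub_sub, sub_neg_eq_add, map_sub, hFl]
  simp [hl]

end Frames

/-- The weighted quadratic form bound behind the choice of `γ²`. -/
lemma min_mul_sum_sq_le {ι : Type*} [Fintype ι] [DecidableEq ι] (i₀ : ι) (c : ι → ℝ)
    {m a b : ℝ} (ha : m ≤ a) (hb : m ≤ b) {lam : ι → ℝ} (hlam0 : lam i₀ = 0) {L : ℝ}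
    (hL : ∀ i, i ≠ i₀ → b ≤ L * lam i ^ 2) :
    m * ∑ i, c i ^ 2 ≤ a * c i₀ ^ 2 + L * ∑ i, lam i ^ 2 * c i ^ 2 := by
  rw [← Finset.add_sum_erase _ _ (Finset.mem_univ i₀),
    ← Finset.add_sum_erase _ (fun i => lam i ^ 2 * c i ^ 2) (Finset.mem_univ i₀), hlam0]
  have h : m * ∑ i ∈ Finset.univ.erase i₀, c i ^ 2
      ≤ L * ∑ i ∈ Finset.univ.erase i₀, lam i ^ 2 * c i ^ 2 := by
    rw [Finset.mul_sum, Finset.mul_sum]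
    refine Finset.sum_le_sum fun i hi => ?_
    rw [← mul_assoc]
    exact mul_le_mul_of_nonneg_right (hb.trans (hL i (Finset.ne_of_mem_erase hi))) (sq_nonneg _)
  nlinarith [mul_le_mul_of_nonneg_right ha (sq_nonneg (c i₀))]

lemma norm_sq_add_norm_sq_le {E F : Type*} [NormedAddCommGroup E] [NormedSpace ℝ E]
    [NormedAddCommGroup F] [NormedSpace ℝ F] {B : E →L[ℝ] F} {M : ℝ} (hM : 0 ≤ M) (hB : ‖B‖ ≤ M)
    (x : E) (y : F) :
    ‖x‖ ^ 2 + ‖y‖ ^ 2 ≤ (2 + M) ^ 2 * (‖y + B x‖ ^ 2 + ‖x‖ ^ 2) := by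
  have hBx : ‖B x‖ ≤ M * ‖x‖ := B.le_of_opNorm_le hB x
  have hy : ‖y‖ ≤ ‖y + B x‖ + M * ‖x‖ := by
    have := norm_sub_le (y + B x) (B x)
    rw [add_sub_cancel_right] at this
    linarith
  have hy2 : ‖y‖ ^ 2 ≤ (‖y + B x‖ + M * ‖x‖) ^ 2 := pow_le_pow_left₀ (norm_nonneg _) hy 2
  nlinarith [sq_nonneg (M * ‖y + B x‖ - ‖x‖), mul_nonneg hM (sq_nonneg ‖x‖),
    mul_nonneg hM (sq_nonneg ‖y + B x‖), sq_nonneg ‖x‖, sq_nonneg ‖y + B x‖]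

lemma differentiable_adjoint_apply {E : Type*} [NormedAddCommGroup E] [InnerProductSpace ℝ E]
    [CompleteSpace E] {A : ℝ → E →L[ℝ] E} {e : ℝ → E} (hA : Differentiable ℝ A)
    (he : Differentiable ℝ e) :
    Differentiable ℝ fun s => ContinuousLinearMap.adjoint (A s) (e s) := by
  have h : Differentiable ℝ fun s => ContinuousLinearMap.adjoint (A s) := hA.star
  exact h.clm_apply he

/-- A Lyapunov functional whose derivative is dominated by `φ` and which vanishes at both ends
forces `∫ φ ≥ 0`; here `φ = (2γ)⁻¹‖w‖² - (γ/2)(‖e‖² + ‖e'‖²)`. -/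
lemma mul_H1norm_le_L2norm_of_hasDerivAt {n : ℕ} {T γ : ℝ} (hT : 0 ≤ T) (hγ : 0 < γ)
    {e w : ℝ → EuclideanSpace ℝ (Fin n)} (he : Continuous e) (he' : Continuous (deriv e))
    (hw : ContinuousOn w (Icc 0 T)) {G G' : ℝ → ℝ} (hG : ∀ t ∈ Icc 0 T, HasDerivAt G (G' t) t)
    (hG0 : G 0 = 0) (hGT : G T = 0)
    (hle : ∀ t ∈ Icc 0 T, G' t ≤ ⟪e t, w t⟫ - γ * (‖e t‖ ^ 2 + ‖deriv e t‖ ^ 2)) :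
    γ * H1norm T e ≤ L2norm T w := by
  have sq_L2 (v : ℝ → EuclideanSpace ℝ (Fin n)) :
      L2norm T v ^ 2 = ∫ t in (0:ℝ)..T, ‖v t‖ ^ 2 :=
    Real.sq_sqrt (intervalIntegral.integral_nonneg hT fun _ _ => sq_nonneg _)
  have ie : IntervalIntegrable (fun t => ‖e t‖ ^ 2) MeasureTheory.volume 0 T :=
    (he.norm.pow 2).intervalIntegrable _ _
  have ie' : IntervalIntegrable (fun t => ‖deriv e t‖ ^ 2) MeasureTheory.volume 0 T :=
    (he'.norm.pow 2).intervalIntegrable _ _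
  have iw : IntervalIntegrable (fun t => ‖w t‖ ^ 2) MeasureTheory.volume 0 T :=
    (hw.norm.pow 2).intervalIntegrable_of_Icc hT
  have key := intervalIntegral.sub_le_integral_of_hasDeriv_right_of_le hT
    (fun t ht => (hG t ht).continuousAt.continuousWithinAt)
    (fun t ht => (hG t (Ioo_subset_Icc_self ht)).hasDerivWithinAt)
    (φ := fun t => (2 * γ)⁻¹ * ‖w t‖ ^ 2 - γ / 2 * (‖e t‖ ^ 2 + ‖deriv e t‖ ^ 2))
    (ContinuousOn.integrableOn_Icc (by fun_prop)) (fun t ht => by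
      refine (hle t (Ioo_subset_Icc_self ht)).trans ?_
      have h1 : ⟪e t, w t⟫ ≤ ‖e t‖ * ‖w t‖ := real_inner_le_norm _ _
      have h2 : ‖e t‖ * ‖w t‖ ≤ γ / 2 * ‖e t‖ ^ 2 + (2 * γ)⁻¹ * ‖w t‖ ^ 2 := by
        have : γ / 2 * ‖e t‖ ^ 2 + (2 * γ)⁻¹ * ‖w t‖ ^ 2 - ‖e t‖ * ‖w t‖
            = (2 * γ)⁻¹ * (γ * ‖e t‖ - ‖w t‖) ^ 2 := by field_simp; ring
        have : 0 ≤ (2 * γ)⁻¹ * (γ * ‖e t‖ - ‖w t‖) ^ 2 := by positivity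
        linarith
      nlinarith [mul_nonneg hγ.le (sq_nonneg ‖deriv e t‖)])
  rw [hG0, hGT, sub_zero, intervalIntegral.integral_sub (iw.const_mul _)
      ((ie.add ie').const_mul _), intervalIntegral.integral_const_mul,
    intervalIntegral.integral_const_mul, intervalIntegral.integral_add ie ie',
    ← sq_L2, ← sq_L2, ← sq_L2] at key
  have hH : H1norm T e ^ 2 = L2norm T e ^ 2 + L2norm T (deriv e) ^ 2 :=
    Real.sq_sqrt (by positivity)
  refine le_of_sq_le_sq ?_ (Real.sqrt_nonneg _)
  rw [mul_pow, hH]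
  have := mul_nonneg (mul_pos two_pos hγ).le key
  have h2 : 2 * γ * ((2 * γ)⁻¹ * L2norm T w ^ 2
      - γ / 2 * (L2norm T e ^ 2 + L2norm T (deriv e) ^ 2))
      = L2norm T w ^ 2 - γ ^ 2 * (L2norm T e ^ 2 + L2norm T (deriv e) ^ 2) := by
    field_simp
  linarith

/-- **Boundedness of the absolute condition number `‖ℒ⁻¹‖`, uniformly in `T`:**
if `ℒe = w` on `[0,T]` and `e(0) = e(T) = 0` then `γ²‖e‖_{H¹} ≤ ‖w‖₂` with a
`T`-independent constant `γ²`. -/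
theorem lss_condition_number_bounded
    (n : ℕ) (T α M : ℝ) (hT : 0 < T) (hα : 0 < α) (hM : 0 ≤ M)
    (A : ℝ → EuclideanSpace ℝ (Fin n) →L[ℝ] EuclideanSpace ℝ (Fin n))
    (hA : ContDiff ℝ 1 A)
    (hAbd : ∀ t ∈ Icc (0:ℝ) T, ‖ContinuousLinearMap.adjoint (A t)‖ ≤ M)
    (g : ℝ → EuclideanSpace ℝ (Fin n)) (hg : ContinuousOn g (Icc 0 T))
    -- adjoint Lyapunov data
    (lam : Fin n → ℝ) (phihat : Fin n → ℝ → EuclideanSpace ℝ (Fin n))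
    (hphi : ∀ i, ∀ t ∈ Icc (0:ℝ) T,
      HasDerivAt (phihat i)
        (-(ContinuousLinearMap.adjoint (A t)) (phihat i t) + lam i • phihat i t) t)
    (cmin cmax : ℝ) (hcmin : 0 < cmin) (hcc : cmin ≤ cmax)
    (hlow : ∀ (c : Fin n → ℝ), ∀ t ∈ Icc (0:ℝ) T,
      cmin * ∑ i, (c i) ^ 2 ≤ ‖∑ i, c i • phihat i t‖ ^ 2)
    (hhigh : ∀ (c : Fin n → ℝ), ∀ t ∈ Icc (0:ℝ) T,
      ‖∑ i, c i • phihat i t‖ ^ 2 ≤ cmax * ∑ i, (c i) ^ 2)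
    (n₀ : Fin n) (hlam0 : lam n₀ = 0) (hlamne : ∀ i, i ≠ n₀ → lam i ≠ 0)
    (horth : ∀ i, ∀ t ∈ Icc (0:ℝ) T,
      ⟪phihat i t, g t⟫ = if i = n₀ then 1 else 0)
    -- Λ² = min_{i ≠ n₀} λᵢ²
    (Λsq : ℝ) (hΛ : IsLeast {x : ℝ | ∃ i, i ≠ n₀ ∧ x = (lam i) ^ 2} Λsq)
    -- the solution `e` of `ℒe = w` with homogeneous boundary conditions
    (e w : ℝ → EuclideanSpace ℝ (Fin n)) (he : ContDiff ℝ 2 e)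
    (he0 : e 0 = 0) (heT : e T = 0)
    (hw : ContinuousOn w (Icc 0 T))
    (heq : ∀ t ∈ Icc (0:ℝ) T, LSSop α A g e t = w t) :
    (1 / (2 + M) ^ 2)
        * min (1 / 2) (min (cmin * Λsq / (2 * cmax)) (1 / (α ^ 2 * cmax)))
        * H1norm T e ≤ L2norm T w := by
  have hcmax : 0 < cmax := hcmin.trans_le hcc
  have hΛpos : 0 < Λsq := by
    obtain ⟨i, hi, h⟩ := hΛ.1
    rw [h]
    exact sq_pos_of_ne_zero (hlamne i hi)
  set m := min (1 / 2) (min (cmin * Λsq / (2 * cmax)) (1 / (α ^ 2 * cmax))) with hm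
  have hmpos : 0 < m := by rw [hm]; positivity
  have hm1 : m ≤ 1 / 2 := min_le_left _ _
  have hm2 : m * cmax ≤ cmin / 2 * Λsq := by
    have h : m ≤ cmin * Λsq / (2 * cmax) := (min_le_right _ _).trans (min_le_left _ _)
    rw [le_div_iff₀ (by positivity)] at h
    linarith
  have hm3 : m * cmax ≤ (α ^ 2)⁻¹ := by
    have h : m ≤ 1 / (α ^ 2 * cmax) := (min_le_right _ _).trans (min_le_right _ _)
    rw [le_div_iff₀ (by positivity)] at h
    rw [le_inv_comm₀ (by positivity) (by positivity), inv_eq_one_div, le_div_iff₀ (by positivity)]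
    linarith
  have hed : Differentiable ℝ e := he.differentiable (by norm_num)
  have he1 : ContDiff ℝ 1 (deriv e) := he.deriv'
  have hed' : Differentiable ℝ (deriv e) := he1.differentiable (by norm_num)
  have hAe := differentiable_adjoint_apply (hA.differentiable (by norm_num)) hed
  set f : ℝ → EuclideanSpace ℝ (Fin n) :=
    fun t => deriv e t + ContinuousLinearMap.adjoint (A t) (e t) with hf
  have hfderiv : ∀ t ∈ Icc (0:ℝ) T,
      HasDerivAt f (A t (f t) + (α ^ 2)⁻¹ • (⟪g t, e t⟫ • g t) - w t) t := by
    intro t ht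
    refine ((hed' t).hasDerivAt.add (hAe t).hasDerivAt).congr_deriv ?_
    rw [← heq t ht, LSSop, hf, map_add]
    abel
  set F := fun t => frameMap fun i => phihat i t with hF
  have hunit : ∀ t ∈ Icc (0:ℝ) T, IsUnit (F t) := fun t ht =>
    isUnit_frameMap hcmin fun c => hlow c t ht
  have hFinv : ∀ t ∈ Icc (0:ℝ) T, ∀ x, ∑ i, (Ring.inverse (F t) x) i • phihat i t = x := by
    intro t ht x
    rw [← frameMap_apply]
    have := congrArg (fun L => L x) (Ring.mul_inverse_cancel (F t) (hunit t ht))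
    simpa using this
  set c := fun t => Ring.inverse (F t) (e t) with hc
  set d := fun t => Ring.inverse (F t) (f t) with hd
  have hcderiv : ∀ i, ∀ t ∈ Icc (0:ℝ) T,
      HasDerivAt (fun s => c s i) (d t i - lam i * c t i) t := fun i t ht =>
    hasDerivAt_frame_coord (hunit t ht) (fun j => hphi j t ht) (hed t).hasDerivAt i
  refine mul_H1norm_le_L2norm_of_hasDerivAt hT.le (by positivity) hed.continuous he1.continuous hw
    (G := fun t => cmin / 2 * ∑ i, lam i * c t i ^ 2 - ⟪e t, f t⟫)
    (fun t ht => ((HasDerivAt.fun_sum fun i _ => ((hcderiv i t ht).fun_pow 2).const_mul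
      (lam i)).const_mul (cmin / 2)).sub ((hed t).hasDerivAt.inner ℝ (hfderiv t ht)))
    (by simp [hc, he0]) (by simp [hc, heT]) fun t ht => ?_
  have hge : ⟪g t, e t⟫ = c t n₀ := by
    rw [← hFinv t ht (e t), inner_sum]
    simp [inner_smul_right, real_inner_comm (phihat _ t) (g t), horth _ t ht, hc]
  have hflow : cmin * ∑ i, d t i ^ 2 ≤ ‖f t‖ ^ 2 := by
    simpa only [hd, hFinv t ht] using hlow (d t) t ht
  have hehigh : ‖e t‖ ^ 2 ≤ cmax * ∑ i, c t i ^ 2 := by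
    simpa only [hc, hFinv t ht] using hhigh (c t) t ht
  have hquad := min_mul_sum_sq_le n₀ (c t) hm3 hm2 hlam0 (L := cmin / 2) fun i hi =>
    mul_le_mul_of_nonneg_left (hΛ.2 ⟨i, hi, rfl⟩) (by positivity)
  have hcross : ∑ i, lam i * (((2 : ℕ) : ℝ) * c t i ^ (2 - 1) * (d t i - lam i * c t i))
      ≤ ∑ i, d t i ^ 2 - ∑ i, lam i ^ 2 * c t i ^ 2 := by
    rw [← Finset.sum_sub_distrib]
    refine Finset.sum_le_sum fun i _ => ?_
    norm_num
    nlinarith [sq_nonneg (d t i - lam i * c t i)]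
  have hcross' := mul_le_mul_of_nonneg_left hcross (half_pos hcmin).le
  have hinner : ⟪e t, A t (f t) + (α ^ 2)⁻¹ • (⟪g t, e t⟫ • g t) - w t⟫ + ⟪deriv e t, f t⟫
      = ‖f t‖ ^ 2 + (α ^ 2)⁻¹ * c t n₀ ^ 2 - ⟪e t, w t⟫ := by
    rw [inner_sub_right, inner_add_right, ← ContinuousLinearMap.adjoint_inner_left,
      inner_smul_right, inner_smul_right, real_inner_comm (g t) (e t), hge,
      ← real_inner_self_eq_norm_sq]
    nth_rw 4 [hf]
    rw [inner_add_left]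
    ring
  have hbd := norm_sq_add_norm_sq_le hM (hAbd t ht) (e t) (deriv e t)
  have hγbd : 1 / (2 + M) ^ 2 * m * (‖e t‖ ^ 2 + ‖deriv e t‖ ^ 2)
      ≤ m * (‖f t‖ ^ 2 + ‖e t‖ ^ 2) := by
    rw [one_div, mul_assoc, inv_mul_le_iff₀ (by positivity)]
    nlinarith [mul_le_mul_of_nonneg_left hbd hmpos.le]
  have hme := mul_le_mul_of_nonneg_left hehigh hmpos.le
  have hmf := mul_le_mul_of_nonneg_right hm1 (sq_nonneg ‖f t‖)
  rw [hinner]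
  linarith
end

section
/- Let T > 0 and let h, q : [0,T] → ℝ^n be continuous. Then ∫₀ᵀ ‖e^{−t}h(t) + e^{−(T−t)}q(t)‖² dt ≤ (sup_{t∈[0,T]}‖h(t)‖² + sup_{t∈[0,T]}‖q(t)‖²)·(1 − e^{−2T})/2 + 2·T·e^{−T}·sup_{t∈[0,T]}(h(t)·q(t)). -/
open scoped RealInnerProductSpace
open Set

/-- Expansion of the squared norm of a sum of two exponentially weighted vectors. -/
theorem norm_exp_smul_add_exp_smul_sq {E : Type*} [NormedAddCommGroup E] [InnerProductSpace ℝ E]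
    (x y : E) (t T : ℝ) :
    ‖Real.exp (-t) • x + Real.exp (-(T - t)) • y‖ ^ 2
      = ‖x‖ ^ 2 * Real.exp (-2 * t) + ‖y‖ ^ 2 * Real.exp (-2 * (T - t))
        + 2 * Real.exp (-T) * ⟪x, y⟫ := by
  have h₁ : Real.exp (-2 * t) = Real.exp (-t) ^ 2 := by
    rw [← Real.exp_nat_mul]; congr 1; push_cast; ring
  have h₂ : Real.exp (-2 * (T - t)) = Real.exp (-(T - t)) ^ 2 := by
    rw [← Real.exp_nat_mul]; congr 1; push_cast; ring
  have h₃ : Real.exp (-T) = Real.exp (-t) * Real.exp (-(T - t)) := by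
    rw [← Real.exp_add]; congr 1; ring
  rw [norm_add_sq_real, norm_smul, norm_smul, real_inner_smul_left, real_inner_smul_right,
    Real.norm_of_nonneg (Real.exp_nonneg _), Real.norm_of_nonneg (Real.exp_nonneg _), h₁, h₂, h₃]
  ring

theorem integral_exp_neg_two_mul (T : ℝ) :
    ∫ t in (0 : ℝ)..T, Real.exp (-2 * t) = (1 - Real.exp (-2 * T)) / 2 := by
  rw [intervalIntegral.integral_comp_mul_left (fun t => Real.exp t) (by norm_num : (-2 : ℝ) ≠ 0),
    integral_exp, mul_zero, Real.exp_zero, smul_eq_mul]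
  ring

theorem integral_exp_neg_two_mul_sub (T : ℝ) :
    ∫ t in (0 : ℝ)..T, Real.exp (-2 * (T - t)) = (1 - Real.exp (-2 * T)) / 2 := by
  rw [intervalIntegral.integral_comp_sub_left (fun t => Real.exp (-2 * t)), sub_self, sub_zero,
    integral_exp_neg_two_mul]

/-- A continuous real function on `[a, b]` is bounded there by its supremum. -/
theorem ContinuousOn.le_sSup_image_of_mem_Icc {f : ℝ → ℝ} {a b t : ℝ} (hf : ContinuousOn f (Icc a b))
    (ht : t ∈ Icc a b) : f t ≤ sSup (f '' Icc a b) :=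
  le_csSup (isCompact_Icc.bddAbove_image hf) (mem_image_of_mem f ht)

/-- **`L²` bound on exponential boundary layers:** for continuous `h, q : [0,T] → ℝⁿ`,
`∫₀ᵀ ‖e^{−t}h(t) + e^{−(T−t)}q(t)‖² dt
  ≤ (sup‖h‖² + sup‖q‖²)(1 − e^{−2T})/2 + 2Te^{−T}·sup(h·q)`. -/
theorem exp_boundary_layer_L2_bound
    (n : ℕ) (T : ℝ) (hT : 0 < T)
    (h q : ℝ → EuclideanSpace ℝ (Fin n))
    (hh : ContinuousOn h (Icc 0 T)) (hq : ContinuousOn q (Icc 0 T)) :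
    (∫ t in (0:ℝ)..T, ‖Real.exp (-t) • h t + Real.exp (-(T - t)) • q t‖ ^ 2)
      ≤ (sSup ((fun t => ‖h t‖ ^ 2) '' Icc (0:ℝ) T)
            + sSup ((fun t => ‖q t‖ ^ 2) '' Icc (0:ℝ) T))
          * (1 - Real.exp (-2 * T)) / 2
        + 2 * T * Real.exp (-T) * sSup ((fun t => ⟪h t, q t⟫) '' Icc (0:ℝ) T) := by
  set A := sSup ((fun t => ‖h t‖ ^ 2) '' Icc (0:ℝ) T)
  set B := sSup ((fun t => ‖q t‖ ^ 2) '' Icc (0:ℝ) T)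
  set C := sSup ((fun t => ⟪h t, q t⟫) '' Icc (0:ℝ) T)
  have h_left : IntervalIntegrable
      (fun t => ‖Real.exp (-t) • h t + Real.exp (-(T - t)) • q t‖ ^ 2) MeasureTheory.volume 0 T := by
    apply ContinuousOn.intervalIntegrable
    rw [uIcc_of_le hT.le]
    fun_prop
  have h_exp : IntervalIntegrable (fun t => A * Real.exp (-2 * t)) MeasureTheory.volume 0 T :=
    Continuous.intervalIntegrable (by fun_prop) _ _
  have h_exp_sub : IntervalIntegrable (fun t => B * Real.exp (-2 * (T - t)))
      MeasureTheory.volume 0 T :=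
    Continuous.intervalIntegrable (by fun_prop) _ _
  have h_const : IntervalIntegrable (fun _ => 2 * Real.exp (-T) * C) MeasureTheory.volume 0 T :=
    intervalIntegrable_const
  calc
    _ ≤ ∫ t in (0:ℝ)..T, (A * Real.exp (-2 * t) + B * Real.exp (-2 * (T - t))
          + 2 * Real.exp (-T) * C) := by
      refine intervalIntegral.integral_mono_on hT.le h_left
        ((h_exp.add h_exp_sub).add h_const) fun t ht => ?_
      rw [norm_exp_smul_add_exp_smul_sq]
      gcongr
      · exact (hh.norm.pow 2).le_sSup_image_of_mem_Icc ht
      · exact (hq.norm.pow 2).le_sSup_image_of_mem_Icc ht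
      · exact (hh.inner hq).le_sSup_image_of_mem_Icc ht
    _ = _ := by
      rw [intervalIntegral.integral_add (h_exp.add h_exp_sub) h_const,
        intervalIntegral.integral_add h_exp h_exp_sub, intervalIntegral.integral_const_mul,
        intervalIntegral.integral_const_mul, integral_exp_neg_two_mul,
        integral_exp_neg_two_mul_sub, intervalIntegral.integral_const, smul_eq_mul]
      ring
end

section
/- Let T > 0, α > 0, M ≥ 0, let A : [0,T] → ℝ^{n×n} be continuously differentiable with ‖A(t)ᵀ‖ ≤ M for all t, let g : [0,T] → ℝ^n be continuous, and suppose adjoint Lyapunov data (λ_i, φ̂_i, c_min, c_max, n₀) on [0,T] is given. If ψ₁, ψ₂ : [0,T] → ℝ^n are twice continuously differentiable with ψ₁(0) = ψ₂(0), ψ₁(T) = ψ₂(T), and (ℒψ₁)(t) = (ℒψ₂)(t) for all t ∈ [0,T], then ψ₁(t) = ψ₂(t) for all t ∈ [0,T]. -/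
open scoped RealInnerProductSpace
open Set

/-- An antiderivative of a nonnegative function on `[a, b]` which vanishes at both end points forces
the function to vanish. -/
theorem eq_zero_of_hasDerivAt_nonneg_of_eq_endpoints {a b : ℝ} (hab : a < b) {h h' : ℝ → ℝ}
    (hd : ∀ t ∈ Icc a b, HasDerivAt h (h' t) t) (hnonneg : ∀ t ∈ Icc a b, 0 ≤ h' t)
    (hends : h a = h b) : ∀ t ∈ Icc a b, h' t = 0 := by
  have hmono : MonotoneOn h (Icc a b) :=
    monotoneOn_of_hasDerivWithinAt_nonneg (convex_Icc a b)
      (fun t ht => (hd t ht).continuousAt.continuousWithinAt)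
      (fun t ht => (hd t (interior_subset ht)).hasDerivWithinAt)
      (fun t ht => hnonneg t (interior_subset ht))
  have hconst : ∀ t ∈ Icc a b, h t = h a := fun t ht => by
    have h₁ := hmono (left_mem_Icc.2 hab.le) ht ht.1
    have h₂ := hmono ht (right_mem_Icc.2 hab.le) ht.2
    linarith
  intro t ht
  have h₀ : HasDerivWithinAt h 0 (Icc a b) t :=
    (hasDerivWithinAt_const t (Icc a b) (h a)).congr hconst (hconst t ht)
  exact (uniqueDiffOn_Icc hab t ht).eq_deriv _ (hd t ht).hasDerivWithinAt h₀

/-- A solution of a linear differential inequality `‖e'‖ ≤ K ‖e‖` starting at `0` vanishes. -/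
theorem eq_zero_of_norm_hasDerivAt_le {E : Type*} [NormedAddCommGroup E] [NormedSpace ℝ E]
    {a b K : ℝ} {e e' : ℝ → E} (hd : ∀ t ∈ Icc a b, HasDerivAt e (e' t) t) (ha : e a = 0)
    (hK : ∀ t ∈ Icc a b, ‖e' t‖ ≤ K * ‖e t‖) : ∀ t ∈ Icc a b, e t = 0 := by
  intro t ht
  have h := norm_le_gronwallBound_of_norm_deriv_right_le (f := e) (f' := e') (δ := 0) (K := K)
    (ε := 0) (fun s hs => (hd s hs).continuousAt.continuousWithinAt)
    (fun s hs => (hd s (Ico_subset_Icc_self hs)).hasDerivWithinAt) (by simp [ha])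
    (fun s hs => by simpa using hK s (Ico_subset_Icc_self hs)) t ht
  simpa [gronwallBound_ε0] using h

/-- **Uniqueness of the adjoint LSS solution:** under uniform hyperbolicity
(adjoint Lyapunov data), two twice continuously differentiable solutions of the adjoint
LSS equation with the same boundary values coincide on `[0,T]`. -/
theorem adjoint_lss_unique
    (n : ℕ) (T α M : ℝ) (hT : 0 < T) (hα : 0 < α) (hM : 0 ≤ M)
    (A : ℝ → EuclideanSpace ℝ (Fin n) →L[ℝ] EuclideanSpace ℝ (Fin n))
    (hA : ContDiff ℝ 1 A)
    (hAbd : ∀ t ∈ Icc (0:ℝ) T, ‖ContinuousLinearMap.adjoint (A t)‖ ≤ M)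
    (g : ℝ → EuclideanSpace ℝ (Fin n)) (hg : ContinuousOn g (Icc 0 T))
    -- adjoint Lyapunov data
    (lam : Fin n → ℝ) (phihat : Fin n → ℝ → EuclideanSpace ℝ (Fin n))
    (hphi : ∀ i, ∀ t ∈ Icc (0:ℝ) T,
      HasDerivAt (phihat i)
        (-(ContinuousLinearMap.adjoint (A t)) (phihat i t) + lam i • phihat i t) t)
    (cmin cmax : ℝ) (hcmin : 0 < cmin) (hcc : cmin ≤ cmax)
    (hlow : ∀ (c : Fin n → ℝ), ∀ t ∈ Icc (0:ℝ) T,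
      cmin * ∑ i, (c i) ^ 2 ≤ ‖∑ i, c i • phihat i t‖ ^ 2)
    (hhigh : ∀ (c : Fin n → ℝ), ∀ t ∈ Icc (0:ℝ) T,
      ‖∑ i, c i • phihat i t‖ ^ 2 ≤ cmax * ∑ i, (c i) ^ 2)
    (n₀ : Fin n) (hlam0 : lam n₀ = 0) (hlamne : ∀ i, i ≠ n₀ → lam i ≠ 0)
    (horth : ∀ i, ∀ t ∈ Icc (0:ℝ) T,
      ⟪phihat i t, g t⟫ = if i = n₀ then 1 else 0)
    -- two solutions with the same boundary values and the same image under ℒ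
    (ψ₁ ψ₂ : ℝ → EuclideanSpace ℝ (Fin n))
    (hψ₁ : ContDiff ℝ 2 ψ₁) (hψ₂ : ContDiff ℝ 2 ψ₂)
    (hbc0 : ψ₁ 0 = ψ₂ 0) (hbcT : ψ₁ T = ψ₂ T)
    (heq : ∀ t ∈ Icc (0:ℝ) T, LSSop α A g ψ₁ t = LSSop α A g ψ₂ t) :
    ∀ t ∈ Icc (0:ℝ) T, ψ₁ t = ψ₂ t := by
  set B := fun s => ContinuousLinearMap.adjoint (A s) with hB
  have hBd : Differentiable ℝ B :=
    (ContinuousLinearMap.adjoint (𝕜 := ℝ) (E := EuclideanSpace ℝ (Fin n))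
      (F := EuclideanSpace ℝ (Fin n))).toContinuousLinearEquiv.differentiable.comp
      (hA.differentiable one_ne_zero)
  have hderiv : ∀ ψ : ℝ → EuclideanSpace ℝ (Fin n), ContDiff ℝ 2 ψ → ∀ t,
      HasDerivAt ψ (deriv ψ t) t ∧ HasDerivAt (fun s => deriv ψ s + B s (ψ s))
        (deriv (deriv ψ) t + deriv (fun s => B s (ψ s)) t) t := fun ψ hψ t => by
    have hψd : Differentiable ℝ ψ := hψ.differentiable two_ne_zero
    have hψd' : Differentiable ℝ (deriv ψ) :=
      ((contDiff_succ_iff_deriv (n := 1)).1 hψ).2.2.differentiable one_ne_zero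
    exact ⟨(hψd t).hasDerivAt,
      (hψd' t).hasDerivAt.add ((hBd t).clm_apply (hψd t)).hasDerivAt⟩
  set e := fun t => ψ₁ t - ψ₂ t with he
  set w := fun t => (deriv ψ₁ t + B t (ψ₁ t)) - (deriv ψ₂ t + B t (ψ₂ t)) with hw
  have hed : ∀ t, HasDerivAt e (w t - B t (e t)) t := fun t => by
    refine ((hderiv ψ₁ hψ₁ t).1.sub (hderiv ψ₂ hψ₂ t).1).congr_deriv ?_
    simp only [hw, he, map_sub]
    abel
  have hwd : ∀ t ∈ Icc (0:ℝ) T,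
      HasDerivAt w (A t (w t) + (α ^ 2)⁻¹ • (⟪g t, e t⟫ • g t)) t := fun t ht => by
    refine ((hderiv ψ₁ hψ₁ t).2.sub (hderiv ψ₂ hψ₂ t).2).congr_deriv (Eq.symm ?_)
    have h := heq t ht
    simp only [LSSop] at h
    rw [← sub_eq_zero] at h ⊢
    rw [← h]
    simp only [hw, he, hB, map_sub, map_add, inner_sub_right, sub_smul, smul_sub]
    abel
  have hwe : ∀ t ∈ Icc (0:ℝ) T,
      HasDerivAt (fun t => ⟪w t, e t⟫) (‖w t‖ ^ 2 + (α ^ 2)⁻¹ * ⟪g t, e t⟫ ^ 2) t :=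
    fun t ht => by
      refine ((hwd t ht).inner ℝ (hed t)).congr_deriv ?_
      simp only [hB, inner_sub_right, inner_add_left, real_inner_smul_left,
        ContinuousLinearMap.adjoint_inner_right, real_inner_self_eq_norm_sq]
      ring
  have hw0 : ∀ t ∈ Icc (0:ℝ) T, w t = 0 := fun t ht => by
    have h := eq_zero_of_hasDerivAt_nonneg_of_eq_endpoints hT hwe (fun t _ => by positivity)
      (by simp [he, hbc0, hbcT]) t ht
    have : 0 ≤ (α ^ 2)⁻¹ * ⟪g t, e t⟫ ^ 2 := by positivity
    have : ‖w t‖ ^ 2 = 0 := le_antisymm (by linarith) (sq_nonneg _)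
    simpa using this
  intro t ht
  refine sub_eq_zero.1 (eq_zero_of_norm_hasDerivAt_le (K := M) (fun t _ => hed t)
    (by simp [he, hbc0]) (fun t ht => ?_) t ht)
  rw [hw0 t ht, zero_sub, norm_neg]
  exact (B t).le_of_opNorm_le (hAbd t ht) _
end

section
/- Let T > 0, α > 0, let A : [0,T] → ℝ^{n×n} and b, g : [0,T] → ℝ^n be continuous. Suppose v, w : [0,T] → ℝ^n are continuously differentiable and η : [0,T] → ℝ is continuous, satisfying for all t ∈ [0,T]: w'(t) + A(t)ᵀw(t) + v(t) = 0 with w(0) = w(T) = 0, w(t)·g(t) = −α²η(t), and v'(t) = A(t)v(t) + b(t) + η(t)g(t). Then for every continuously differentiable ṽ : [0,T] → ℝ^n and continuous η̃ : [0,T] → ℝ with ṽ'(t) = A(t)ṽ(t) + b(t) + η̃(t)g(t) for all t, one has ∫₀ᵀ (‖v(t)‖² + α²η(t)²) dt ≤ ∫₀ᵀ (‖ṽ(t)‖² + α²η̃(t)²) dt. -/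
open scoped RealInnerProductSpace
open Set

/-- Pairing a solution of the adjoint equation vanishing at both ends of the interval with a solution
of the linearized equation kills the integral of the cross terms. -/
theorem integral_inner_add_eq_zero_of_adjoint {E : Type*} [NormedAddCommGroup E]
    [InnerProductSpace ℝ E] [CompleteSpace E] {T : ℝ} (hT : 0 ≤ T) {A : ℝ → E →L[ℝ] E}
    {v w d r : ℝ → E} {c : ℝ → ℝ} (hvc : ContinuousOn v (Icc 0 T)) (hcc : ContinuousOn c (Icc 0 T))
    (hw : ∀ t ∈ Icc (0 : ℝ) T,
      HasDerivAt w (-(ContinuousLinearMap.adjoint (A t)) (w t) - v t) t)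
    (hw0 : w 0 = 0) (hwT : w T = 0)
    (hd : ∀ t ∈ Icc (0 : ℝ) T, HasDerivAt d (A t (d t) + r t) t)
    (hc : ∀ t ∈ Icc (0 : ℝ) T, ⟪w t, r t⟫ = -c t) :
    ∫ t in (0 : ℝ)..T, (⟪v t, d t⟫ + c t) = 0 := by
  have hderiv : ∀ t ∈ uIcc (0 : ℝ) T,
      HasDerivAt (fun t => -⟪w t, d t⟫) (⟪v t, d t⟫ + c t) t := by
    intro t ht
    rw [uIcc_of_le hT] at ht
    refine ((hw t ht).inner ℝ (hd t ht)).neg.congr_deriv ?_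
    rw [inner_sub_left, inner_neg_left, inner_add_right, hc t ht,
      ContinuousLinearMap.adjoint_inner_left]
    ring
  have hdc : ContinuousOn d (Icc 0 T) := fun t ht => (hd t ht).continuousAt.continuousWithinAt
  rw [intervalIntegral.integral_eq_sub_of_hasDerivAt hderiv
    (((hvc.inner hdc).add hcc).intervalIntegrable_of_Icc hT)]
  simp [hw0, hwT]

/-- **Any solution of the LSS optimality (KKT) system is a global minimizer** of the
least-squares shadowing objective `∫₀ᵀ(‖v‖² + α²η²)dt` over all `(vtil, etatil)` satisfying the
linearized constraint `vtil' = Avtil + b + etatilg`. -/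
theorem lss_kkt_global_min
    (n : ℕ) (T α : ℝ) (hT : 0 < T) (hα : 0 < α)
    (A : ℝ → EuclideanSpace ℝ (Fin n) →L[ℝ] EuclideanSpace ℝ (Fin n))
    (b g : ℝ → EuclideanSpace ℝ (Fin n))
    (hA : ContinuousOn A (Icc 0 T)) (hb : ContinuousOn b (Icc 0 T))
    (hg : ContinuousOn g (Icc 0 T))
    (v w : ℝ → EuclideanSpace ℝ (Fin n)) (η : ℝ → ℝ)
    (hη : ContinuousOn η (Icc 0 T))
    -- w' + Aᵀw + v = 0,  w(0) = w(T) = 0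
    (hw : ∀ t ∈ Icc (0:ℝ) T,
      HasDerivAt w (-(ContinuousLinearMap.adjoint (A t)) (w t) - v t) t)
    (hw0 : w 0 = 0) (hwT : w T = 0)
    -- w·g = −α²η
    (hwg : ∀ t ∈ Icc (0:ℝ) T, ⟪w t, g t⟫ = -(α ^ 2) * η t)
    -- v' = Av + b + ηg
    (hv : ∀ t ∈ Icc (0:ℝ) T,
      HasDerivAt v ((A t) (v t) + b t + η t • g t) t) :
    ∀ (vtil : ℝ → EuclideanSpace ℝ (Fin n)) (etatil : ℝ → ℝ),
      ContinuousOn etatil (Icc 0 T) →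
      (∀ t ∈ Icc (0:ℝ) T, HasDerivAt vtil ((A t) (vtil t) + b t + etatil t • g t) t) →
      (∫ t in (0:ℝ)..T, (‖v t‖ ^ 2 + α ^ 2 * (η t) ^ 2))
        ≤ ∫ t in (0:ℝ)..T, (‖vtil t‖ ^ 2 + α ^ 2 * (etatil t) ^ 2) := by
  intro vtil etatil hetatil hvtil
  have hvc : ContinuousOn v (Icc 0 T) := fun t ht => (hv t ht).continuousAt.continuousWithinAt
  have hvtilc : ContinuousOn vtil (Icc 0 T) :=
    fun t ht => (hvtil t ht).continuousAt.continuousWithinAt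
  have hcc : ContinuousOn (fun t => α ^ 2 * (η t * (etatil t - η t))) (Icc 0 T) := by fun_prop
  have hcross : ∫ t in (0 : ℝ)..T,
      (⟪v t, vtil t - v t⟫ + α ^ 2 * (η t * (etatil t - η t))) = 0 := by
    refine integral_inner_add_eq_zero_of_adjoint (A := A) (d := fun t => vtil t - v t)
      (r := fun t => (etatil t - η t) • g t) hT.le hvc hcc hw hw0 hwT (fun t ht => ?_)
      (fun t ht => ?_)
    · refine ((hvtil t ht).sub (hv t ht)).congr_deriv ?_
      rw [map_sub, sub_smul]
      abel
    · rw [inner_smul_right, hwg t ht]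
      ring
  have hcost : IntervalIntegrable (fun t => ‖v t‖ ^ 2 + α ^ 2 * (η t) ^ 2)
      MeasureTheory.volume 0 T :=
    ContinuousOn.intervalIntegrable_of_Icc hT.le (by fun_prop)
  have hcosttil : IntervalIntegrable (fun t => ‖vtil t‖ ^ 2 + α ^ 2 * (etatil t) ^ 2)
      MeasureTheory.volume 0 T :=
    ContinuousOn.intervalIntegrable_of_Icc hT.le (by fun_prop)
  have hcrossint : IntervalIntegrable
      (fun t => 2 * (⟪v t, vtil t - v t⟫ + α ^ 2 * (η t * (etatil t - η t))))
      MeasureTheory.volume 0 T :=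
    ContinuousOn.intervalIntegrable_of_Icc hT.le
      (((hvc.inner (hvtilc.sub hvc)).add hcc).const_smul (2 : ℝ))
  have hle := intervalIntegral.integral_mono_on hT.le (hcost.add hcrossint) hcosttil
    (fun t _ => by
      have hsq := norm_add_sq_real (v t) (vtil t - v t)
      rw [add_sub_cancel] at hsq
      nlinarith [sq_nonneg ‖vtil t - v t‖, sq_nonneg (α * (etatil t - η t))])
  rwa [intervalIntegral.integral_add hcost hcrossint, intervalIntegral.integral_const_mul, hcross,
    mul_zero, add_zero] at hle
end

section
/- Let T > 0, α > 0, J̄ ∈ ℝ, and let A : [0,T] → ℝ^{n×n}, b, g, j : [0,T] → ℝ^n and J₀ : [0,T] → ℝ be continuous. Suppose v, w, ψ, r : [0,T] → ℝ^n are continuously differentiable and η : [0,T] → ℝ is continuous, satisfying for all t ∈ [0,T]: (forward system) w' + Aᵀw + v = 0 with w(0) = w(T) = 0, w·g = −α²η, and v' = Av + b + ηg; (adjoint system) ψ' + Aᵀψ + j = r with ψ(0) = ψ(T) = 0, and r' − Ar = (1/α²)(ψ·g + J₀ − J̄)g. Then ∫₀ᵀ ( j(t)·v(t) + η(t)(J₀(t)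 − J̄) ) dt = ∫₀ᵀ ψ(t)·b(t) dt. -/
open scoped RealInnerProductSpace
open Set

/-- **Equivalence of the forward and adjoint LSS sensitivities:**
if `(v, η, w)` solves the forward LSS optimality system and `(ψ, r)` solves the adjoint
LSS system, then `∫₀ᵀ (j·v + η(J₀ − J̄)) dt = ∫₀ᵀ ψ·b dt`. -/
theorem forward_eq_adjoint_lss_sensitivity
    (n : ℕ) (T α Jbar : ℝ) (hT : 0 < T) (hα : 0 < α)
    (A : ℝ → EuclideanSpace ℝ (Fin n) →L[ℝ] EuclideanSpace ℝ (Fin n))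
    (b g j : ℝ → EuclideanSpace ℝ (Fin n)) (J₀ : ℝ → ℝ)
    (hA : ContinuousOn A (Icc 0 T)) (hb : ContinuousOn b (Icc 0 T))
    (hg : ContinuousOn g (Icc 0 T)) (hj : ContinuousOn j (Icc 0 T))
    (hJ₀ : ContinuousOn J₀ (Icc 0 T))
    (v w ψ r : ℝ → EuclideanSpace ℝ (Fin n)) (η : ℝ → ℝ)
    (hη : ContinuousOn η (Icc 0 T))
    -- forward system: w' + Aᵀw + v = 0, w(0) = w(T) = 0, w·g = −α²η, v' = Av + b + ηg
    (hw : ∀ t ∈ Icc (0:ℝ) T,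
      HasDerivAt w (-(ContinuousLinearMap.adjoint (A t)) (w t) - v t) t)
    (hw0 : w 0 = 0) (hwT : w T = 0)
    (hwg : ∀ t ∈ Icc (0:ℝ) T, ⟪w t, g t⟫ = -(α ^ 2) * η t)
    (hv : ∀ t ∈ Icc (0:ℝ) T,
      HasDerivAt v ((A t) (v t) + b t + η t • g t) t)
    -- adjoint system: ψ' + Aᵀψ + j = r, ψ(0) = ψ(T) = 0,
    -- r' − Ar = (1/α²)(ψ·g + J₀ − J̄)g
    (hψ : ∀ t ∈ Icc (0:ℝ) T,
      HasDerivAt ψ (r t - (ContinuousLinearMap.adjoint (A t)) (ψ t) - j t) t)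
    (hψ0 : ψ 0 = 0) (hψT : ψ T = 0)
    (hr : ∀ t ∈ Icc (0:ℝ) T,
      HasDerivAt r ((A t) (r t)
        + (α ^ 2)⁻¹ • ((⟪ψ t, g t⟫ + J₀ t - Jbar) • g t)) t) :
    (∫ t in (0:ℝ)..T, (⟪j t, v t⟫ + η t * (J₀ t - Jbar)))
      = ∫ t in (0:ℝ)..T, ⟪ψ t, b t⟫ := by
  have hvc : ContinuousOn v (Icc 0 T) := fun t ht => (hv t ht).continuousAt.continuousWithinAt
  have hψc : ContinuousOn ψ (Icc 0 T) := fun t ht => (hψ t ht).continuousAt.continuousWithinAt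
  have hforward : IntervalIntegrable (fun t => ⟪j t, v t⟫ + η t * (J₀ t - Jbar))
      MeasureTheory.volume 0 T :=
    ((hj.inner hvc).add (hη.mul (hJ₀.sub continuousOn_const))).intervalIntegrable_of_Icc hT.le
  have hadjoint : IntervalIntegrable (fun t => ⟪ψ t, b t⟫) MeasureTheory.volume 0 T :=
    (hψc.inner hb).intervalIntegrable_of_Icc hT.le
  have hderiv : ∀ t ∈ uIcc (0:ℝ) T, HasDerivAt (fun s => ⟪ψ s, v s⟫ + ⟪w s, r s⟫)
      (⟪ψ t, b t⟫ - (⟪j t, v t⟫ + η t * (J₀ t - Jbar))) t := by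
    intro t ht
    rw [uIcc_of_le hT.le] at ht
    refine (((hψ t ht).inner ℝ (hv t ht)).add ((hw t ht).inner ℝ (hr t ht))).congr_deriv ?_
    simp only [inner_add_right, inner_sub_left, inner_neg_left, inner_smul_right,
      ContinuousLinearMap.adjoint_inner_left, hwg t ht, real_inner_comm (v t) (r t)]
    field_simp
    ring
  have hzero := intervalIntegral.integral_eq_sub_of_hasDerivAt hderiv (hadjoint.sub hforward)
  rw [intervalIntegral.integral_sub hadjoint hforward] at hzero
  simp only [hψ0, hψT, hw0, hwT, inner_zero_left, add_zero, sub_zero] at hzero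
  linarith
end
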